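/- For every α > 0 and every x₀ > 0 there exist θ₁ > 0 and C > 0 such that for all 0 < θ < θ₁ one has M_{x₀} < 2, the coefficient B is nonzero, and |R − (Γ(α+1)/(2i)^(α+2))·θ| ≤ C·θ^(1+min(1/α, 1)). -/

import Mathlib

open MeasureTheory Set Filter Topology

noncomputable section

/-- The wave speed profile `c(x) = (1 + θ (x₊)^α)^(-1/2)`. -/
def spd (α θ x : ℝ) : ℝ := (1 + θ * (max x 0) ^ α) ^ (-(1 / 2) : ℝ)

/-- The WKB amplitude `b(x) = c(x)^(1/2)`. -/
def amp (α θ x : ℝ) : ℝ := spd α θ x ^ ((1 : ℝ) / 2)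

/-- The WKB phase `φ(x) = ∫₀ˣ c(y)⁻¹ dy`. -/
def phase (α θ x : ℝ) : ℝ := ∫ y in (0:ℝ)..x, (spd α θ y)⁻¹

/-- `M(x) = c(x)^(1/2) (c^(1/2))''(x)` for `x > 0`, and `0` for `x ≤ 0`. -/
def Mfun (α θ x : ℝ) : ℝ :=
  if 0 < x then
    spd α θ x ^ ((1 : ℝ) / 2) * deriv (deriv (fun y => spd α θ y ^ ((1 : ℝ) / 2))) x
  else 0

/-- `M_{x₀} = ∫_{x₀}^∞ |M(x)| dx`. -/
def Mtail (α θ x₀ : ℝ) : ℝ := ∫ x in Ioi x₀, |Mfun α θ x|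

/-- The Volterra operator `K_σ`. -/
def Kop (α θ x₀ σ : ℝ) (f : ℝ → ℂ) (x : ℝ) : ℂ :=
  (2 * Complex.I * (1 + Complex.I * (σ : ℂ)))⁻¹ *
    ((∫ y in x₀..x, (Mfun α θ y : ℂ) * f y *
        Complex.exp (-2 * Complex.I * (1 + Complex.I * (σ : ℂ)) *
          ((phase α θ x - phase α θ y : ℝ) : ℂ))) +
      ∫ y in Ioi x, (Mfun α θ y : ℂ) * f y)

/-- The right-going WKB wave `v^> = b e^{-iφ}`. -/
def vplus (α θ x : ℝ) : ℂ := (amp α θ x : ℂ) * Complex.exp (-Complex.I * (phase α θ x : ℂ))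

/-- The left-going WKB wave `v^< = b e^{iφ}`. -/
def vminus (α θ x : ℝ) : ℂ := (amp α θ x : ℂ) * Complex.exp (Complex.I * (phase α θ x : ℂ))

/-- `S` is a bounded continuous solution on `[x₀,∞)` of `S = e^{-2iφ} + K₀ S`. -/
def IsVolterraSol (α θ x₀ : ℝ) (S : ℝ → ℂ) : Prop :=
  (∃ C, ∀ x ∈ Ici x₀, ‖S x‖ ≤ C) ∧ ContinuousOn S (Ici x₀) ∧
    ∀ x ∈ Ici x₀, S x = Complex.exp (-2 * Complex.I * (phase α θ x : ℂ)) + Kop α θ x₀ 0 S x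

/-- `R_{x₀} = (2i)⁻¹ ∫_{x₀}^∞ M S^>`. -/
def Rx (α θ x₀ : ℝ) (S : ℝ → ℂ) : ℂ :=
  (2 * Complex.I)⁻¹ * ∫ x in Ioi x₀, (Mfun α θ x : ℂ) * S x

/-! ### The wave speed profile -/

lemma spd_base_pos (α : ℝ) {θ : ℝ} (hθ : 0 ≤ θ) (x : ℝ) : 0 < 1 + θ * (max x 0) ^ α := by
  have : 0 ≤ (max x 0) ^ α := Real.rpow_nonneg (le_max_right _ _) _
  positivity

lemma spd_pos (α : ℝ) {θ : ℝ} (hθ : 0 ≤ θ) (x : ℝ) : 0 < spd α θ x :=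
  Real.rpow_pos_of_pos (spd_base_pos α hθ x) _

lemma spd_le_one (α : ℝ) {θ : ℝ} (hθ : 0 ≤ θ) (x : ℝ) : spd α θ x ≤ 1 := by
  have : 0 ≤ (max x 0) ^ α := Real.rpow_nonneg (le_max_right _ _) _
  exact Real.rpow_le_one_of_one_le_of_nonpos (by nlinarith [mul_nonneg hθ this]) (by norm_num)

lemma spd_sq_mul_base (α : ℝ) {θ : ℝ} (hθ : 0 ≤ θ) (x : ℝ) :
    spd α θ x ^ 2 * (1 + θ * (max x 0) ^ α) = 1 := by
  have h := spd_base_pos α hθ x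
  rw [spd, ← Real.rpow_natCast, ← Real.rpow_mul h.le]
  norm_num
  rw [Real.rpow_neg_one, inv_mul_cancel₀ h.ne']

lemma spd_sq_mul (α : ℝ) {θ x : ℝ} (hθ : 0 ≤ θ) (hx : 0 < x) :
    spd α θ x ^ 2 * (1 + θ * x ^ α) = 1 := by
  simpa [max_eq_left hx.le] using spd_sq_mul_base α hθ x

lemma spd_zero (α x : ℝ) : spd α 0 x = 1 := by simp [spd]

lemma one_sub_spd_sq (α : ℝ) {θ x : ℝ} (hθ : 0 ≤ θ) (hx : 0 < x) :
    1 - spd α θ x ^ 2 = θ * x ^ α * spd α θ x ^ 2 := by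
  linarith [spd_sq_mul α hθ hx]

lemma one_sub_spd_sq_nonneg (α : ℝ) {θ : ℝ} (hθ : 0 ≤ θ) (x : ℝ) : 0 ≤ 1 - spd α θ x ^ 2 := by
  nlinarith [spd_pos α hθ x, spd_le_one α hθ x]

lemma one_sub_spd_sq_le (α : ℝ) {θ x : ℝ} (hθ : 0 ≤ θ) (hx : 0 < x) :
    1 - spd α θ x ^ 2 ≤ θ * x ^ α := by
  rw [one_sub_spd_sq α hθ hx]
  have := spd_le_one α hθ x
  have := spd_pos α hθ x
  exact mul_le_of_le_one_right (mul_nonneg hθ (Real.rpow_nonneg hx.le _)) (by nlinarith)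

lemma one_sub_spd_le (α : ℝ) {θ x : ℝ} (hθ : 0 ≤ θ) (hx : 0 < x) :
    1 - spd α θ x ≤ θ * x ^ α := by
  have := one_sub_spd_sq_le α hθ hx
  have := spd_le_one α hθ x
  have := spd_pos α hθ x
  nlinarith

lemma continuous_spd {α θ : ℝ} (hα : 0 < α) (hθ : 0 ≤ θ) : Continuous (spd α θ) := by
  refine Continuous.rpow_const ?_ fun x => Or.inl (spd_base_pos α hθ x).ne'
  exact continuous_const.add (continuous_const.mul
    ((continuous_id.max continuous_const).rpow_const fun _ => Or.inr hα.le))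

lemma hasDerivAt_spd (α : ℝ) {θ x : ℝ} (hθ : 0 ≤ θ) (hx : 0 < x) :
    HasDerivAt (spd α θ) (-(α / 2) * spd α θ x * (1 - spd α θ x ^ 2) / x) x := by
  have hq : 0 < 1 + θ * x ^ α := by simpa [max_eq_left hx.le] using spd_base_pos α hθ x
  have h1 : HasDerivAt (fun y : ℝ => (1 + θ * y ^ α) ^ (-(1 / 2) : ℝ))
      ((θ * (α * x ^ (α - 1))) * (-(1 / 2)) * (1 + θ * x ^ α) ^ (-(1 / 2) - 1 : ℝ)) x :=
    (((Real.hasDerivAt_rpow_const (Or.inl hx.ne')).const_mul θ).const_add 1).rpow_const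
      (Or.inl hq.ne')
  have heq : spd α θ =ᶠ[𝓝 x] fun y : ℝ => (1 + θ * y ^ α) ^ (-(1 / 2) : ℝ) := by
    filter_upwards [lt_mem_nhds hx] with y hy
    simp [spd, max_eq_left (le_of_lt hy)]
  refine (h1.congr_of_eventuallyEq heq).congr_deriv ?_
  rw [one_sub_spd_sq α hθ hx, Real.rpow_sub_one hx.ne', Real.rpow_sub_one hq.ne']
  have hs : (1 + θ * x ^ α) ^ (-(1 / 2) : ℝ) = spd α θ x := by simp [spd, max_eq_left hx.le]
  rw [hs]
  have := spd_sq_mul α hθ hx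
  have h2 : spd α θ x ^ 2 = (1 + θ * x ^ α)⁻¹ := eq_inv_of_mul_eq_one_left this
  rw [h2]
  field_simp

/-! ### The algebra generated by `1/x` and the profile -/

/-- Functions of `(θ, x)` that are complex polynomials in `1/x` and `spd α θ x`. -/
def profileAlg (α : ℝ) : Subalgebra ℂ (ℝ → ℝ → ℂ) :=
  Algebra.adjoin ℂ {fun (_ x : ℝ) => (x : ℂ)⁻¹, fun (θ x : ℝ) => (spd α θ x : ℂ)}

lemma inv_mem_profileAlg (α : ℝ) : (fun _ x => (x : ℂ)⁻¹ : ℝ → ℝ → ℂ) ∈ profileAlg α :=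
  Algebra.subset_adjoin (by simp)

lemma spd_mem_profileAlg (α : ℝ) : (fun θ x => (spd α θ x : ℂ) : ℝ → ℝ → ℂ) ∈ profileAlg α :=
  Algebra.subset_adjoin (by simp)

lemma const_mem_profileAlg (α : ℝ) (c : ℂ) : (fun _ _ => c : ℝ → ℝ → ℂ) ∈ profileAlg α :=
  (profileAlg α).algebraMap_mem c

lemma exists_deriv_of_mem_profileAlg {α : ℝ} {f : ℝ → ℝ → ℂ} (hf : f ∈ profileAlg α) :
    ∃ g ∈ profileAlg α, ∀ θ x : ℝ, 0 ≤ θ → 0 < x → HasDerivAt (f θ) (g θ x / x) x := by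
  unfold profileAlg at hf
  induction hf using Algebra.adjoin_induction with
  | mem f hf =>
    rcases hf with rfl | rfl
    · refine ⟨_, neg_mem (inv_mem_profileAlg α), fun θ x _ hx => ?_⟩
      have := (hasDerivAt_inv hx.ne').ofReal_comp
      simp only [Complex.ofReal_inv] at this
      refine this.congr_deriv ?_
      simp [div_eq_mul_inv, sq]
    · refine ⟨_, mul_mem (mul_mem (const_mem_profileAlg α (-(α / 2))) (spd_mem_profileAlg α))
        (sub_mem (one_mem _) (pow_mem (spd_mem_profileAlg α) 2)), fun θ x hθ hx => ?_⟩
      refine (hasDerivAt_spd α hθ hx).ofReal_comp.congr_deriv ?_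
      simp
  | algebraMap c =>
    exact ⟨0, zero_mem _, fun θ x _ _ =>
      (hasDerivAt_const x c).congr_deriv (by simp)⟩
  | add f g _ _ ihf ihg =>
    obtain ⟨f', hf', hf⟩ := ihf
    obtain ⟨g', hg', hg⟩ := ihg
    exact ⟨f' + g', add_mem hf' hg', fun θ x hθ hx =>
      ((hf θ x hθ hx).add (hg θ x hθ hx)).congr_deriv (by simp [add_div])⟩
  | mul f g hfm hgm ihf ihg =>
    obtain ⟨f', hf', hf⟩ := ihf
    obtain ⟨g', hg', hg⟩ := ihg
    exact ⟨f' * g + f * g', add_mem (mul_mem hf' hgm) (mul_mem hfm hg'), fun θ x hθ hx =>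
      ((hf θ x hθ hx).mul (hg θ x hθ hx)).congr_deriv (by simp; ring)⟩

lemma exists_bound_of_mem_profileAlg {α a : ℝ} (ha : 0 < a) {f : ℝ → ℝ → ℂ}
    (hf : f ∈ profileAlg α) :
    ∃ C, 0 ≤ C ∧ ∀ θ x : ℝ, 0 ≤ θ → a ≤ x → ‖f θ x‖ ≤ C := by
  unfold profileAlg at hf
  induction hf using Algebra.adjoin_induction with
  | mem f hf =>
    rcases hf with rfl | rfl
    · refine ⟨a⁻¹, by positivity, fun θ x _ hx => ?_⟩
      have : 0 < x := ha.trans_le hx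
      simp only [norm_inv, Complex.norm_real, Real.norm_of_nonneg this.le]
      gcongr
    · refine ⟨1, zero_le_one, fun θ x hθ hx => ?_⟩
      simpa [abs_of_pos (spd_pos α hθ x)] using spd_le_one α hθ x
  | algebraMap c => exact ⟨‖c‖, norm_nonneg _, fun _ _ _ _ => le_rfl⟩
  | add f g _ _ ihf ihg =>
    obtain ⟨C, hC, hf⟩ := ihf
    obtain ⟨D, hD, hg⟩ := ihg
    exact ⟨C + D, by positivity, fun θ x hθ hx =>
      norm_add_le_of_le (hf θ x hθ hx) (hg θ x hθ hx)⟩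
  | mul f g _ _ ihf ihg =>
    obtain ⟨C, hC, hf⟩ := ihf
    obtain ⟨D, hD, hg⟩ := ihg
    exact ⟨C * D, by positivity, fun θ x hθ hx =>
      norm_mul_le_of_le (hf θ x hθ hx) (hg θ x hθ hx)⟩

lemma exists_lipschitz_of_mem_profileAlg {α a : ℝ} (ha : 0 < a) {f : ℝ → ℝ → ℂ}
    (hf : f ∈ profileAlg α) :
    ∃ C, 0 ≤ C ∧ ∀ θ x : ℝ, 0 ≤ θ → a ≤ x → ‖f θ x - f 0 x‖ ≤ C * (θ * x ^ α) := by
  unfold profileAlg at hf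
  induction hf using Algebra.adjoin_induction with
  | mem f hf =>
    rcases hf with rfl | rfl
    · exact ⟨0, le_rfl, fun θ x _ hx => by simp⟩
    · refine ⟨1, zero_le_one, fun θ x hθ hx => ?_⟩
      have h := one_sub_spd_le α hθ (ha.trans_le hx)
      change ‖(spd α θ x : ℂ) - (spd α 0 x : ℂ)‖ ≤ _
      rw [spd_zero, ← Complex.ofReal_sub, Complex.norm_real, Real.norm_eq_abs, abs_sub_comm,
        abs_of_nonneg (by linarith [spd_le_one α hθ x])]
      simpa using h
  | algebraMap c => exact ⟨0, le_rfl, fun θ x _ hx => by simp⟩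
  | add f g _ _ ihf ihg =>
    obtain ⟨C, hC, hf⟩ := ihf
    obtain ⟨D, hD, hg⟩ := ihg
    refine ⟨C + D, by positivity, fun θ x hθ hx => ?_⟩
    calc ‖(f + g) θ x - (f + g) 0 x‖ = ‖(f θ x - f 0 x) + (g θ x - g 0 x)‖ := by
          simp only [Pi.add_apply]; congr 1; ring
      _ ≤ _ := norm_add_le_of_le (hf θ x hθ hx) (hg θ x hθ hx)
      _ = _ := by ring
  | mul f g hfm hgm ihf ihg =>
    obtain ⟨C, hC, hf⟩ := ihf
    obtain ⟨D, hD, hg⟩ := ihg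
    obtain ⟨C', hC', hf'⟩ := exists_bound_of_mem_profileAlg ha hfm
    obtain ⟨D', hD', hg'⟩ := exists_bound_of_mem_profileAlg ha hgm
    refine ⟨C * D' + C' * D, by positivity, fun θ x hθ hx => ?_⟩
    calc ‖(f * g) θ x - (f * g) 0 x‖ = ‖(f θ x - f 0 x) * g θ x + f 0 x * (g θ x - g 0 x)‖ := by
          simp only [Pi.mul_apply]; congr 1; ring
      _ ≤ C * (θ * x ^ α) * D' + C' * (D * (θ * x ^ α)) :=
          norm_add_le_of_le (norm_mul_le_of_le (hf θ x hθ hx) (hg' θ x hθ hx))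
            (norm_mul_le_of_le (hf' 0 x le_rfl hx) (hg θ x hθ hx))
      _ = _ := by ring

lemma continuousOn_of_mem_profileAlg {α θ : ℝ} (hθ : 0 ≤ θ) {f : ℝ → ℝ → ℂ}
    (hf : f ∈ profileAlg α) : ContinuousOn (f θ) (Ioi 0) := by
  obtain ⟨g, -, hg⟩ := exists_deriv_of_mem_profileAlg hf
  exact fun x hx => (hg θ x hθ hx).continuousAt.continuousWithinAt

/-- Approximate solutions of the WKB Riccati equation to arbitrary order in `ε = spd / x`: the
logarithmic derivative is `spd⁻¹ * (-i + ε * (1 - spd ^ 2) * (-α / 4 + ε * H))`. -/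
lemma exists_wkb_expansion (α : ℝ) (n : ℕ) :
    ∃ H ∈ profileAlg α, ∃ H' ∈ profileAlg α, ∃ G ∈ profileAlg α,
      (∀ θ x : ℝ, 0 ≤ θ → 0 < x → HasDerivAt (H θ) (H' θ x / x) x) ∧
      ∀ θ x : ℝ, ∀ s ε k : ℂ, 0 ≤ θ → 0 < x → s = spd α θ x → ε = s * (x : ℂ)⁻¹ →
        k = -α / 4 + ε * H θ x →
        -Complex.I * α / 2 - 2 * Complex.I * k +
          ε * (ε * (H' θ x - (1 + α / 2 * (1 - s ^ 2)) * H θ x) +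
            (α - 1 - α * (1 - s ^ 2)) * k + (1 - s ^ 2) * k ^ 2) = ε ^ (n + 1) * G θ x := by
  have hs := spd_mem_profileAlg α
  have hε := mul_mem hs (inv_mem_profileAlg α)
  have hc := const_mem_profileAlg α
  have hh := sub_mem (one_mem (profileAlg α)) (pow_mem hs 2)
  induction n with
  | zero =>
    refine ⟨0, zero_mem _, 0, zero_mem _, _,
      add_mem (mul_mem (sub_mem (hc (α - 1)) (mul_mem (hc α) hh)) (hc (-α / 4)))
        (mul_mem hh (pow_mem (hc (-α / 4)) 2)), fun θ x _ _ => ?_, ?_⟩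
    · simp
    · rintro θ x s ε k - - rfl rfl rfl
      simp
      ring
  | succ n ih =>
    obtain ⟨H, hH, H', hH', G, hG, hder, hid⟩ := ih
    obtain ⟨G', hG', hGder⟩ := exists_deriv_of_mem_profileAlg hG
    have hm := mul_mem (hc (2 * Complex.I)⁻¹) hG
    have hm' := mul_mem (hc (2 * Complex.I)⁻¹) hG'
    have hw := add_mem (hc 1) (mul_mem (hc (α / 2)) hh)
    have hk := add_mem (hc (-α / 4)) (mul_mem hε hH)
    refine ⟨_, add_mem hH (mul_mem (pow_mem hε n) hm), _,
      add_mem hH' (mul_mem (pow_mem hε n) (sub_mem hm' (mul_mem (hc n) (mul_mem hw hm)))), _,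
      add_mem (sub_mem hm' (mul_mem (hc (n + 1)) (mul_mem hw hm)))
        (add_mem (mul_mem (sub_mem (hc (α - 1)) (mul_mem (hc α) hh)) hm)
          (mul_mem hh (add_mem (mul_mem (hc 2) (mul_mem hk hm))
            (mul_mem (pow_mem hε (n + 1)) (pow_mem hm 2))))), fun θ x hθ hx => ?_, ?_⟩
    · have hx0 : (x : ℂ) ≠ 0 := by exact_mod_cast hx.ne'
      have h1 := (hasDerivAt_spd α hθ hx).ofReal_comp
      have h2 := (hasDerivAt_inv hx.ne').ofReal_comp
      simp only [Complex.ofReal_inv] at h2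
      have h3 := (hder θ x hθ hx).add (((h1.mul h2).pow n).mul
        ((hGder θ x hθ hx).const_mul (2 * Complex.I)⁻¹))
      refine h3.congr_deriv ?_
      rcases n with _ | n <;> simp [div_eq_mul_inv] <;> ring
    · intro θ x s ε k hθ hx hs hε hk
      have hid' := hid θ x s ε _ hθ hx hs hε rfl
      have hI : (2 * Complex.I)⁻¹ * (2 * Complex.I) = 1 := inv_mul_cancel₀ (by simp)
      subst hk
      simp only [Pi.add_apply, Pi.mul_apply, Pi.sub_apply, Pi.pow_apply, Pi.one_apply]
      simp only [← hs, ← hε]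
      generalize (2 * Complex.I)⁻¹ = j at hI ⊢
      linear_combination hid' - ε ^ (n + 1) * G θ x * hI
/-! ### Estimates for functions with power-law derivative bounds -/

lemma norm_sub_le_of_norm_deriv_le_rpow {f f' : ℝ → ℂ} {x y C β : ℝ} (hβ : β ≠ -1) (hx : 0 < x)
    (hxy : x ≤ y) (hf : ∀ t ∈ Icc x y, HasDerivAt f (f' t) t)
    (hf' : ∀ t ∈ Icc x y, ‖f' t‖ ≤ C * t ^ β) :
    ‖f y - f x‖ ≤ C * ((y ^ (β + 1) - x ^ (β + 1)) / (β + 1)) := by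
  have hβ' : β + 1 ≠ 0 := fun h => hβ (by linarith)
  have hB : ∀ t ∈ Icc x y, HasDerivAt
      (fun t : ℝ => C * ((t ^ (β + 1) - x ^ (β + 1)) / (β + 1))) (C * t ^ β) t := by
    intro t ht
    have h := (((Real.hasDerivAt_rpow_const (p := β + 1)
      (Or.inl (hx.trans_le ht.1).ne')).sub_const (x ^ (β + 1))).div_const (β + 1)).const_mul C
    refine h.congr_deriv ?_
    rw [add_sub_cancel_right]
    field_simp
  refine image_norm_le_of_norm_deriv_right_le_deriv_boundary' (f := fun t => f t - f x) (f' := f')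
    (B := fun t => C * ((t ^ (β + 1) - x ^ (β + 1)) / (β + 1)))
    (B' := fun t => C * t ^ β) (a := x) (b := y) ?_ ?_ (by simp) ?_ ?_ ?_ ⟨hxy, le_rfl⟩
  · exact fun t ht => ((hf t ht).sub_const (f x)).continuousAt.continuousWithinAt
  · exact fun t ht => ((hf t (Ico_subset_Icc_self ht)).sub_const (f x)).hasDerivWithinAt
  · exact fun t ht => (hB t ht).continuousAt.continuousWithinAt
  · exact fun t ht => (hB t (Ico_subset_Icc_self ht)).hasDerivWithinAt
  · exact fun t ht => hf' t (Ico_subset_Icc_self ht)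

lemma norm_sub_le_of_norm_deriv_le_rpow_of_lt {f f' : ℝ → ℂ} {x y C β : ℝ} (hβ : β < -1)
    (hC : 0 ≤ C) (hx : 0 < x) (hxy : x ≤ y) (hf : ∀ t ∈ Icc x y, HasDerivAt f (f' t) t)
    (hf' : ∀ t ∈ Icc x y, ‖f' t‖ ≤ C * t ^ β) :
    ‖f y - f x‖ ≤ C * (x ^ (β + 1) / (-(β + 1))) := by
  refine (norm_sub_le_of_norm_deriv_le_rpow hβ.ne hx hxy hf hf').trans ?_
  have h1 : 0 < -(β + 1) := by linarith
  have h2 : 0 ≤ y ^ (β + 1) := Real.rpow_nonneg (hx.le.trans hxy) _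
  rw [← neg_div_neg_eq (y ^ (β + 1) - x ^ (β + 1))]
  gcongr
  linarith

lemma norm_sub_le_of_norm_deriv_le_rpow_of_gt {f f' : ℝ → ℂ} {x y C β : ℝ} (hβ : -1 < β)
    (hC : 0 ≤ C) (hx : 0 < x) (hxy : x ≤ y) (hf : ∀ t ∈ Icc x y, HasDerivAt f (f' t) t)
    (hf' : ∀ t ∈ Icc x y, ‖f' t‖ ≤ C * t ^ β) :
    ‖f y - f x‖ ≤ C * (y ^ (β + 1) / (β + 1)) := by
  refine (norm_sub_le_of_norm_deriv_le_rpow hβ.ne' hx hxy hf hf').trans ?_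
  have h1 : 0 < β + 1 := by linarith
  have h2 : 0 ≤ x ^ (β + 1) := Real.rpow_nonneg hx.le _
  gcongr
  linarith

lemma norm_le_of_norm_deriv_le_rpow_of_tendsto {f f' : ℝ → ℂ} {x C β : ℝ} (hβ : β < -1)
    (hC : 0 ≤ C) (hx : 0 < x) (hf : ∀ t ∈ Ici x, HasDerivAt f (f' t) t)
    (hf' : ∀ t ∈ Ici x, ‖f' t‖ ≤ C * t ^ β) (h0 : Tendsto f atTop (𝓝 0)) :
    ‖f x‖ ≤ C * (x ^ (β + 1) / (-(β + 1))) := by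
  have h1 : Tendsto (fun y => ‖f y - f x‖) atTop (𝓝 ‖0 - f x‖) := (h0.sub_const _).norm
  rw [zero_sub, norm_neg] at h1
  refine le_of_tendsto h1 ?_
  filter_upwards [eventually_ge_atTop x] with y hy
  exact norm_sub_le_of_norm_deriv_le_rpow_of_lt hβ hC hx hy (fun t ht => hf t ht.1)
    (fun t ht => hf' t ht.1)

lemma integrableOn_Ioi_of_norm_le_rpow {f : ℝ → ℂ} {a C β : ℝ} (hβ : β < -1) (ha : 0 < a)
    (hf : ContinuousOn f (Ici a)) (hf' : ∀ t ∈ Ici a, ‖f t‖ ≤ C * t ^ β) :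
    IntegrableOn f (Ioi a) := by
  refine ((integrableOn_Ioi_rpow_of_lt hβ ha).const_mul C).mono'
    ((hf.mono Ioi_subset_Ici_self).aestronglyMeasurable measurableSet_Ioi) ?_
  filter_upwards [ae_restrict_mem measurableSet_Ioi] with t ht using hf' t (Ioi_subset_Ici_self ht)

lemma norm_integral_Ioi_le_of_norm_le_rpow {f : ℝ → ℂ} {a C β : ℝ} (hβ : β < -1) (ha : 0 < a)
    (hf' : ∀ t ∈ Ioi a, ‖f t‖ ≤ C * t ^ β) :
    ‖∫ t in Ioi a, f t‖ ≤ C * (a ^ (β + 1) / (-(β + 1))) := by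
  have h : ‖∫ t in Ioi a, f t‖ ≤ ∫ t in Ioi a, C * t ^ β := by
    refine norm_integral_le_of_norm_le ((integrableOn_Ioi_rpow_of_lt hβ ha).const_mul C) ?_
    filter_upwards [ae_restrict_mem measurableSet_Ioi] with t ht using hf' t ht
  rw [integral_const_mul, integral_Ioi_rpow_of_lt hβ ha] at h
  rwa [div_neg, ← neg_div]

lemma hasDerivAt_integral_Ioi {f : ℝ → ℂ} {a x : ℝ} (hf : IntegrableOn f (Ioi a))
    (hc : ContinuousOn f (Ici a)) (hx : a < x) :
    HasDerivAt (fun z => ∫ y in Ioi z, f y) (-f x) x := by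
  have hi : ∀ z, a ≤ z → IntervalIntegrable f volume a z := fun z hz =>
    (intervalIntegrable_iff_integrableOn_Ioc_of_le hz).2 (hf.mono_set Ioc_subset_Ioi_self)
  have h1 : HasDerivAt (fun z => ∫ y in a..z, f y) (f x) x :=
    intervalIntegral.integral_hasDerivAt_right (hi x hx.le)
      ((hc.mono Ioi_subset_Ici_self).stronglyMeasurableAtFilter isOpen_Ioi x hx)
      (hc.continuousAt (Ici_mem_nhds hx))
  have h2 := h1.const_sub (∫ y in Ioi a, f y)
  refine h2.congr_of_eventuallyEq ?_
  filter_upwards [lt_mem_nhds hx] with z hz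
  rw [← intervalIntegral.integral_Ioi_sub_Ioi hf (le_of_lt hz), sub_sub_cancel]

/-! ### Damped oscillatory integrals -/

lemma norm_rpow_mul_exp {ρ : ℂ} (β : ℝ) {y : ℝ} (hy : 0 < y) (z : ℂ) :
    ‖((y ^ β : ℝ) : ℂ) * z * Complex.exp (-ρ * y)‖ = y ^ β * ‖z‖ * Real.exp (-ρ.re * y) := by
  rw [norm_mul, norm_mul, Complex.norm_real, Real.norm_of_nonneg (Real.rpow_nonneg hy.le _),
    Complex.norm_exp]
  simp

lemma integrableOn_damped {a : ℝ} (ha : 0 < a) {f : ℝ → ℂ} (hf : ContinuousOn f (Ici a)) {K : ℝ}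
    (hK : ∀ y ∈ Ici a, ‖f y‖ ≤ K) (β : ℝ) {ρ : ℂ} (hρ : 0 < ρ.re) :
    IntegrableOn (fun y : ℝ => ((y ^ β : ℝ) : ℂ) * f y * Complex.exp (-ρ * y)) (Ioi a) ∧
      Tendsto (fun y : ℝ => ((y ^ β : ℝ) : ℂ) * f y * Complex.exp (-ρ * y)) atTop (𝓝 0) := by
  have hcr : ContinuousOn (fun y : ℝ => y ^ β) (Ici a) := fun y hy =>
    (Real.continuousAt_rpow_const y β (Or.inl (ha.trans_le hy).ne')).continuousWithinAt
  have hlim : Tendsto (fun y : ℝ => y ^ β * Real.exp (-ρ.re * y)) atTop (𝓝 0) := by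
    have := (isLittleO_rpow_exp_pos_mul_atTop β hρ).tendsto_div_nhds_zero
    refine this.congr fun y => ?_
    rw [neg_mul, Real.exp_neg, div_eq_mul_inv]
  constructor
  · have h1 : IntegrableOn (fun y : ℝ => y ^ β * Real.exp (-ρ.re * y)) (Ioi a) := by
      refine integrable_of_isBigO_exp_neg (half_pos hρ)
        (hcr.mul (by fun_prop)) ?_
      have h := (isLittleO_rpow_exp_pos_mul_atTop β (half_pos hρ)).isBigO.mul
        (Asymptotics.isBigO_refl (fun y : ℝ => Real.exp (-ρ.re * y)) atTop)
      refine h.congr_right fun y => ?_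
      rw [← Real.exp_add]
      ring_nf
    refine (h1.const_mul K).mono' ?_ ?_
    · refine ContinuousOn.aestronglyMeasurable ?_ measurableSet_Ioi
      refine ContinuousOn.mono ?_ Ioi_subset_Ici_self
      exact ((Complex.continuous_ofReal.comp_continuousOn hcr).mul hf).mul (by fun_prop)
    · filter_upwards [ae_restrict_mem measurableSet_Ioi] with y hy
      rw [norm_rpow_mul_exp β (ha.trans hy)]
      have := hK y (Ioi_subset_Ici_self hy)
      have h2 : 0 ≤ y ^ β := Real.rpow_nonneg (ha.trans hy).le _
      calc y ^ β * ‖f y‖ * Real.exp (-ρ.re * y) ≤ y ^ β * K * Real.exp (-ρ.re * y) := by gcongr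
        _ = K * (y ^ β * Real.exp (-ρ.re * y)) := by ring
  · have hlimK := hlim.const_mul K
    rw [mul_zero] at hlimK
    refine squeeze_zero_norm' ?_ hlimK
    filter_upwards [eventually_ge_atTop a] with y hy
    rw [norm_rpow_mul_exp β (ha.trans_le hy)]
    have := hK y hy
    have h2 : 0 ≤ y ^ β := Real.rpow_nonneg (ha.trans_le hy).le _
    calc y ^ β * ‖f y‖ * Real.exp (-ρ.re * y) ≤ y ^ β * K * Real.exp (-ρ.re * y) := by gcongr
      _ = K * (y ^ β * Real.exp (-ρ.re * y)) := by ring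

lemma hasDerivAt_rpow_mul_exp {f : ℝ → ℂ} {f' : ℂ} {x : ℝ} (hx : 0 < x)
    (hf : HasDerivAt f (f' / x) x) (β : ℝ) (ρ : ℂ) :
    HasDerivAt (fun y : ℝ => ((y ^ β : ℝ) : ℂ) * f y * Complex.exp (-ρ * y))
      (((x ^ (β - 1) : ℝ) : ℂ) * (β * f x + f') * Complex.exp (-ρ * x) -
        ρ * (((x ^ β : ℝ) : ℂ) * f x * Complex.exp (-ρ * x))) x := by
  have h1 := (Real.hasDerivAt_rpow_const (p := β) (Or.inl hx.ne')).ofReal_comp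
  have h2 : HasDerivAt (fun y : ℝ => Complex.exp (-ρ * y)) (Complex.exp (-ρ * x) * (-ρ * 1)) x :=
    ((hasDerivAt_id x).ofReal_comp.const_mul (-ρ)).cexp
  refine ((h1.mul hf).mul h2).congr_deriv ?_
  have hx0 : (x : ℂ) ≠ 0 := by exact_mod_cast hx.ne'
  simp only [Pi.mul_apply]
  rw [Real.rpow_sub_one hx.ne']
  push_cast
  field_simp
  ring

/-- Uniform boundedness of damped oscillatory integrals as the damping tends to `0`. -/
lemma exists_bound_integral_damped {α a : ℝ} (ha : 0 < a) (n : ℕ) :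
    ∀ β : ℝ, β ≤ n - 2 → ∀ g ∈ profileAlg α, ∃ C, ∀ δ : ℝ, 0 < δ →
      ‖∫ y in Ioi a, ((y ^ β : ℝ) : ℂ) * g 0 y * Complex.exp (-(δ + 2 * Complex.I) * y)‖ ≤ C := by
  induction n with
  | zero =>
    intro β hβ g hg
    obtain ⟨K, hK, hgK⟩ := exists_bound_of_mem_profileAlg ha hg
    refine ⟨K * (a ^ (β + 1) / (-(β + 1))), fun δ hδ => ?_⟩
    refine norm_integral_Ioi_le_of_norm_le_rpow (by norm_num at hβ; linarith) ha fun y hy => ?_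
    have hy0 : 0 < y := ha.trans hy
    rw [norm_rpow_mul_exp β hy0]
    have h1 := hgK 0 y le_rfl (le_of_lt hy)
    have h2 : 0 ≤ y ^ β := Real.rpow_nonneg hy0.le _
    have h3 : Real.exp (-(δ + 2 * Complex.I).re * y) ≤ 1 :=
      Real.exp_le_one_iff.2 (by simp; positivity)
    calc y ^ β * ‖g 0 y‖ * Real.exp (-(δ + 2 * Complex.I).re * y) ≤ y ^ β * K * 1 := by gcongr
      _ = K * y ^ β := by ring
  | succ n ih =>
    intro β hβ g hg
    obtain ⟨g', hg', hder⟩ := exists_deriv_of_mem_profileAlg hg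
    have hw : (fun _ _ => (β : ℂ) : ℝ → ℝ → ℂ) * g + g' ∈ profileAlg α :=
      add_mem (mul_mem (const_mem_profileAlg α β) hg) hg'
    obtain ⟨C, hC⟩ := ih (β - 1) (by push_cast at hβ; linarith) _ hw
    obtain ⟨K, hK, hgK⟩ := exists_bound_of_mem_profileAlg ha hg
    obtain ⟨L, hL, hwL⟩ := exists_bound_of_mem_profileAlg ha hw
    have hsub : Ici a ⊆ Ioi (0 : ℝ) := fun y hy => ha.trans_le hy
    refine ⟨C + a ^ β * K, fun δ hδ => ?_⟩
    set ρ : ℂ := δ + 2 * Complex.I with hρ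
    have hre : 0 < ρ.re := by simpa [hρ] using hδ
    have h1 := integrableOn_damped ha ((continuousOn_of_mem_profileAlg le_rfl hg).mono hsub)
      (fun y hy => hgK 0 y le_rfl hy) β hre
    have h2 := integrableOn_damped ha ((continuousOn_of_mem_profileAlg le_rfl hw).mono hsub)
      (fun y hy => hwL 0 y le_rfl hy) (β - 1) hre
    have h3 := integral_Ioi_of_hasDerivAt_of_tendsto'
      (fun y hy => hasDerivAt_rpow_mul_exp (hsub hy) (hder 0 y le_rfl (hsub hy)) β ρ)
      (h2.1.sub (h1.1.const_mul ρ)) h1.2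
    have h4 := integral_sub h2.1 (h1.1.const_mul ρ)
    simp only [Pi.add_apply, Pi.mul_apply] at h4
    rw [h3, integral_const_mul] at h4
    have h5 := hC δ hδ
    simp only [Pi.add_apply, Pi.mul_apply] at h5
    rw [← hρ] at h5
    have h6 : ‖ρ * ∫ y in Ioi a, ((y ^ β : ℝ) : ℂ) * g 0 y * Complex.exp (-ρ * y)‖ ≤
        C + a ^ β * K := by
      have : ρ * ∫ y in Ioi a, ((y ^ β : ℝ) : ℂ) * g 0 y * Complex.exp (-ρ * y) =
          (∫ y in Ioi a, ((y ^ (β - 1) : ℝ) : ℂ) * (β * g 0 y + g' 0 y) * Complex.exp (-ρ * y)) +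
            ((a ^ β : ℝ) : ℂ) * g 0 a * Complex.exp (-ρ * a) := by
        linear_combination h4
      rw [this]
      refine norm_add_le_of_le h5 ?_
      rw [norm_rpow_mul_exp β ha]
      have h7 := hgK 0 a le_rfl le_rfl
      have h8 : Real.exp (-ρ.re * a) ≤ 1 := Real.exp_le_one_iff.2 (by nlinarith)
      calc a ^ β * ‖g 0 a‖ * Real.exp (-ρ.re * a) ≤ a ^ β * K * 1 := by gcongr
        _ = a ^ β * K := mul_one _
    have h9 : 1 ≤ ‖ρ‖ := by
      have := Complex.abs_im_le_norm ρ
      have h10 : ρ.im = 2 := by simp [hρ]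
      rw [h10] at this
      norm_num at this
      linarith
    rw [norm_mul] at h6
    refine le_trans ?_ h6
    exact le_mul_of_one_le_left (norm_nonneg _) h9

lemma integrableOn_rpow_mul_exp_neg {β δ : ℝ} (hβ : -1 < β) (hδ : 0 < δ) :
    IntegrableOn (fun t : ℝ => t ^ β * Real.exp (-δ * t)) (Ioi 0) := by
  simpa using integrableOn_rpow_mul_exp_neg_mul_rpow hβ one_pos hδ

lemma integrableOn_rpow_mul_cexp {β : ℝ} {ρ : ℂ} (hβ : 0 < β) (hρ : 0 < ρ.re) :
    IntegrableOn (fun t : ℝ => ((t ^ β : ℝ) : ℂ) * Complex.exp (-ρ * t)) (Ioi 0) := by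
  refine (integrableOn_rpow_mul_exp_neg (β := β) (δ := ρ.re) (by linarith) hρ).mono' ?_ ?_
  · refine Continuous.aestronglyMeasurable ?_
    have := Real.continuous_rpow_const hβ.le
    fun_prop
  · filter_upwards [ae_restrict_mem measurableSet_Ioi] with t ht
    have := norm_rpow_mul_exp (ρ := ρ) β ht 1
    rw [mul_one, norm_one, mul_one] at this
    exact this.le

/-- The Gamma integral along a rotated exponential. -/
lemma integral_rpow_mul_cexp {α δ : ℝ} (hα : 0 < α) (hδ : 0 < δ) (τ : ℝ) :
    ∫ t in Ioi (0 : ℝ), ((t ^ α : ℝ) : ℂ) * Complex.exp (-(δ + τ * Complex.I) * t) =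
      Real.Gamma (α + 1) / (δ + τ * Complex.I) ^ ((α : ℂ) + 1) := by
  set ρ : ℝ → ℂ := fun τ => δ + τ * Complex.I with hρ
  have hre : ∀ τ, (ρ τ).re = δ := fun τ => by simp [hρ]
  have hpos : ∀ τ, 0 < (ρ τ).re := fun τ => by rw [hre]; exact hδ
  have hne : ∀ τ, ρ τ ≠ 0 := fun τ h => by have := hpos τ; simp [h] at this
  set J : ℝ → ℂ := fun τ => ∫ t in Ioi (0 : ℝ), ((t ^ α : ℝ) : ℂ) * Complex.exp (-(ρ τ) * t)
    with hJ
  have hρd : ∀ τ, HasDerivAt ρ Complex.I τ := fun τ => by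
    exact (((hasDerivAt_id τ).ofReal_comp.mul_const Complex.I).const_add (δ : ℂ)).congr_deriv
      (by simp)
  have hparts : ∀ τ, ρ τ * ∫ t in Ioi (0 : ℝ), ((t ^ (α + 1) : ℝ) : ℂ) *
      Complex.exp (-(ρ τ) * t) = (α + 1) * J τ := by
    intro τ
    have h1 := integrableOn_rpow_mul_cexp hα (hpos τ)
    have h2 := integrableOn_rpow_mul_cexp (by linarith : 0 < α + 1) (hpos τ)
    have hd : ∀ t ∈ Ioi (0 : ℝ), HasDerivAt
        (fun y : ℝ => ((y ^ (α + 1) : ℝ) : ℂ) * Complex.exp (-(ρ τ) * y))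
        ((α + 1) * (((t ^ α : ℝ) : ℂ) * Complex.exp (-(ρ τ) * t)) -
          ρ τ * (((t ^ (α + 1) : ℝ) : ℂ) * Complex.exp (-(ρ τ) * t))) t := by
      intro t ht
      have := hasDerivAt_rpow_mul_exp (f := fun _ => 1) (f' := 0) ht
        (by simpa using hasDerivAt_const t (1 : ℂ)) (α + 1) (ρ τ)
      simp only [mul_one, add_zero, add_sub_cancel_right] at this
      refine this.congr_deriv ?_
      push_cast
      ring
    have h3 := integral_Ioi_of_hasDerivAt_of_tendsto (m := 0)
      (f := fun y : ℝ => ((y ^ (α + 1) : ℝ) : ℂ) * Complex.exp (-(ρ τ) * y)) ?_ hd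
      ((h1.const_mul _).sub (h2.const_mul _)) ?_
    · rw [integral_sub (h1.const_mul _) (h2.const_mul _), integral_const_mul,
        integral_const_mul, Real.zero_rpow (by linarith)] at h3
      simp only [Complex.ofReal_zero, zero_mul, sub_zero] at h3
      linear_combination -h3
    · have := Real.continuous_rpow_const (by linarith : 0 ≤ α + 1)
      exact Continuous.continuousWithinAt (by fun_prop)
    · have := (integrableOn_damped one_pos (continuousOn_const (c := (1 : ℂ)))
        (K := 1) (fun y _ => by simp) (α + 1) (hpos τ)).2
      simpa using this
  have hJd : ∀ τ, HasDerivAt J (-Complex.I * ∫ t in Ioi (0 : ℝ), ((t ^ (α + 1) : ℝ) : ℂ) *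
      Complex.exp (-(ρ τ) * t)) τ := by
    intro τ
    rw [← integral_const_mul]
    refine (hasDerivAt_integral_of_dominated_loc_of_deriv_le (s := univ)
      (F := fun τ t => ((t ^ α : ℝ) : ℂ) * Complex.exp (-(ρ τ) * t))
      (F' := fun τ t => -Complex.I * (((t ^ (α + 1) : ℝ) : ℂ) * Complex.exp (-(ρ τ) * t)))
      (bound := fun t : ℝ => t ^ (α + 1) * Real.exp (-δ * t)) Filter.univ_mem ?_
      (integrableOn_rpow_mul_cexp hα (hpos τ)) ?_ ?_
      (integrableOn_rpow_mul_exp_neg (by linarith) hδ) ?_).2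
    · exact Eventually.of_forall fun τ => (integrableOn_rpow_mul_cexp hα (hpos τ)).1
    · exact ((integrableOn_rpow_mul_cexp (by linarith : 0 < α + 1) (hpos τ)).const_mul _).1
    · filter_upwards [ae_restrict_mem measurableSet_Ioi] with t ht σ _
      have := norm_rpow_mul_exp (ρ := ρ σ) (α + 1) ht 1
      rw [mul_one, norm_one, mul_one, hre] at this
      rw [norm_mul, this]
      simp
    · filter_upwards [ae_restrict_mem measurableSet_Ioi] with t ht σ _
      have h := ((((hρd σ).neg).mul_const (t : ℂ)).cexp).const_mul (((t ^ α : ℝ) : ℂ))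
      refine h.congr_deriv ?_
      rw [Real.rpow_add_one (ne_of_gt ht)]
      push_cast
      simp only [Pi.neg_apply]
      ring
  have hconst : ∀ τ, HasDerivAt (fun τ => J τ * ρ τ ^ ((α : ℂ) + 1)) 0 τ := by
    intro τ
    have h1 : HasDerivAt (fun τ => ρ τ ^ ((α : ℂ) + 1))
        (((α : ℂ) + 1) * ρ τ ^ ((α : ℂ) + 1 - 1) * Complex.I) τ :=
      (((hasDerivAt_id (ρ τ)).cpow_const (Or.inl (hpos τ))).comp τ (hρd τ)).congr_deriv (by simp)
    refine ((hJd τ).mul h1).congr_deriv ?_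
    have h2 : ρ τ ^ ((α : ℂ) + 1) = ρ τ * ρ τ ^ ((α : ℂ) + 1 - 1) := by
      rw [add_sub_cancel_right, Complex.cpow_add _ _ (hne τ), Complex.cpow_one, mul_comm]
    rw [h2]
    linear_combination (-Complex.I * ρ τ ^ ((α : ℂ) + 1 - 1)) * hparts τ
  have hcpow : ∀ τ, ρ τ ^ ((α : ℂ) + 1) ≠ 0 := fun τ => by simp [Complex.cpow_eq_zero_iff, hne τ]
  have heq : J τ * ρ τ ^ ((α : ℂ) + 1) = J 0 * ρ 0 ^ ((α : ℂ) + 1) :=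
    is_const_of_deriv_eq_zero (fun τ => (hconst τ).differentiableAt)
      (fun τ => (hconst τ).deriv) τ 0
  have h0 : J 0 * ρ 0 ^ ((α : ℂ) + 1) = Real.Gamma (α + 1) := by
    have h1 := Real.integral_rpow_mul_exp_neg_mul_Ioi (by linarith : 0 < α + 1) hδ
    have h2 : J 0 = ((∫ t in Ioi (0 : ℝ), t ^ (α + 1 - 1) * Real.exp (-(δ * t)) : ℝ) : ℂ) := by
      rw [← integral_complex_ofReal]
      simp [hJ, hρ]
    have h3 : ρ 0 ^ ((α : ℂ) + 1) = ((δ ^ (α + 1) : ℝ) : ℂ) := by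
      rw [Complex.ofReal_cpow hδ.le]
      simp [hρ]
    rw [h2, h3, h1, ← Complex.ofReal_mul, mul_right_comm, ← Real.mul_rpow (by positivity) hδ.le,
      one_div, inv_mul_cancel₀ hδ.ne', Real.one_rpow, one_mul]
  rw [eq_div_iff (hcpow τ), ← h0]
  exact heq

/-- The boundary value of the Gamma integral on the imaginary axis, in terms of an asymptotic
solution `x ^ α * q 0 x` of `Q' = 2 i Q - x ^ α`. -/
lemma boundary_add_integral_eq_Gamma {α a N : ℝ} (hα : 0 < α) (ha : 0 < a) (hN : α - N < -1)
    {q G : ℝ → ℝ → ℂ} (hq : q ∈ profileAlg α) (hG : G ∈ profileAlg α)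
    (hd : ∀ x, 0 < x → HasDerivAt (fun y : ℝ => ((y ^ α : ℝ) : ℂ) * q 0 y)
      (2 * Complex.I * (((x ^ α : ℝ) : ℂ) * q 0 x) - ((x ^ α : ℝ) : ℂ) +
        ((x ^ (α - N) : ℝ) : ℂ) * G 0 x) x) :
    ((a ^ α : ℝ) : ℂ) * q 0 a * Complex.exp (-(2 * Complex.I) * a) +
        (∫ y in Ioi a, ((y ^ (α - N) : ℝ) : ℂ) * G 0 y * Complex.exp (-(2 * Complex.I) * y)) +
        ∫ y in (0 : ℝ)..a, ((y ^ α : ℝ) : ℂ) * Complex.exp (-(2 * Complex.I) * y) =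
      Real.Gamma (α + 1) / (2 * Complex.I) ^ ((α : ℂ) + 1) := by
  have hsub : Ici a ⊆ Ioi (0 : ℝ) := fun y hy => ha.trans_le hy
  obtain ⟨K, hK, hqK⟩ := exists_bound_of_mem_profileAlg ha hq
  obtain ⟨L, hL, hGL⟩ := exists_bound_of_mem_profileAlg ha hG
  have hcont := Real.continuous_rpow_const hα.le
  have hqc := (continuousOn_of_mem_profileAlg le_rfl hq).mono hsub
  have hGc := (continuousOn_of_mem_profileAlg le_rfl hG).mono hsub
  obtain ⟨n, hn⟩ := exists_nat_ge (α + 2)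
  obtain ⟨C, hC⟩ := exists_bound_integral_damped (α := α) ha n α (by linarith) q hq
  set ρ : ℝ → ℂ := fun δ => δ + 2 * Complex.I with hρ
  have hre : ∀ δ, (ρ δ).re = δ := fun δ => by simp [hρ]
  have hρ0 : ρ 0 = 2 * Complex.I := by simp [hρ]
  have hρc : Continuous ρ := by fun_prop
  have key : ∀ δ : ℝ, 0 < δ →
      ((a ^ α : ℝ) : ℂ) * q 0 a * Complex.exp (-(ρ δ) * a) +
        (∫ y in Ioi a, ((y ^ (α - N) : ℝ) : ℂ) * G 0 y * Complex.exp (-(ρ δ) * y)) +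
        (∫ y in (0 : ℝ)..a, ((y ^ α : ℝ) : ℂ) * Complex.exp (-(ρ δ) * y)) -
        δ * (∫ y in Ioi a, ((y ^ α : ℝ) : ℂ) * q 0 y * Complex.exp (-(ρ δ) * y)) =
      Real.Gamma (α + 1) / (ρ δ) ^ ((α : ℂ) + 1) := by
    intro δ hδ
    have hδ' : 0 < (ρ δ).re := by rwa [hre]
    have i1 := integrableOn_damped ha hqc (fun y hy => hqK 0 y le_rfl hy) α hδ'
    have i2 := integrableOn_damped ha hGc (fun y hy => hGL 0 y le_rfl hy) (α - N) hδ'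
    have i3 := integrableOn_rpow_mul_cexp hα hδ'
    have i3a := i3.mono_set (Ioi_subset_Ioi ha.le)
    have h1 : ∀ x ∈ Ici a, HasDerivAt
        (fun y : ℝ => ((y ^ α : ℝ) : ℂ) * q 0 y * Complex.exp (-(ρ δ) * y))
        (((x ^ (α - N) : ℝ) : ℂ) * G 0 x * Complex.exp (-(ρ δ) * x) -
          ((x ^ α : ℝ) : ℂ) * Complex.exp (-(ρ δ) * x) -
          δ * (((x ^ α : ℝ) : ℂ) * q 0 x * Complex.exp (-(ρ δ) * x))) x := by
      intro x hx
      have h2 : HasDerivAt (fun y : ℝ => Complex.exp (-(ρ δ) * y))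
          (Complex.exp (-(ρ δ) * x) * (-(ρ δ) * 1)) x :=
        ((hasDerivAt_id x).ofReal_comp.const_mul (-(ρ δ))).cexp
      refine ((hd x (hsub hx)).mul h2).congr_deriv ?_
      simp only [hρ]
      ring
    have h3 := integral_Ioi_of_hasDerivAt_of_tendsto' h1
      ((i2.1.sub i3a).sub (i1.1.const_mul (δ : ℂ))) i1.2
    have h4 := integral_sub (i2.1.sub i3a) (i1.1.const_mul (δ : ℂ))
    simp only [Pi.sub_apply] at h4
    rw [h3, integral_sub i2.1 i3a, integral_const_mul] at h4
    have h5 := intervalIntegral.integral_interval_add_Ioi i3 i3a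
    have h6 := integral_rpow_mul_cexp hα hδ 2
    have h7 : (δ + ((2 : ℝ) : ℂ) * Complex.I : ℂ) = ρ δ := by simp [hρ]
    rw [h7] at h6
    rw [← h6, ← h5]
    linear_combination -h4
  have hIoi : ∀ᶠ δ in 𝓝[>] (0 : ℝ), 0 < δ := self_mem_nhdsWithin
  have hexp : ∀ y : ℝ, Tendsto (fun δ => Complex.exp (-(ρ δ) * y)) (𝓝[>] 0)
      (𝓝 (Complex.exp (-(2 * Complex.I) * y))) := by
    intro y
    rw [← hρ0]
    exact tendsto_nhdsWithin_of_tendsto_nhds (Continuous.tendsto (by fun_prop) 0)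
  have hexp1 : ∀ δ y : ℝ, 0 < δ → 0 ≤ y → ‖Complex.exp (-(ρ δ) * y)‖ ≤ 1 := by
    intro δ y hδ hy
    rw [Complex.norm_exp, Real.exp_le_one_iff]
    have : (-(ρ δ) * y).re = -(δ * y) := by simp [hρ]
    rw [this]
    have := mul_nonneg hδ.le hy
    linarith
  have t1 : Tendsto (fun δ => ∫ y in Ioi a, ((y ^ (α - N) : ℝ) : ℂ) * G 0 y *
      Complex.exp (-(ρ δ) * y)) (𝓝[>] 0) (𝓝 (∫ y in Ioi a, ((y ^ (α - N) : ℝ) : ℂ) * G 0 y *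
        Complex.exp (-(2 * Complex.I) * y))) := by
    refine tendsto_integral_filter_of_dominated_convergence (fun y => L * y ^ (α - N)) ?_ ?_
      ((integrableOn_Ioi_rpow_of_lt hN ha).const_mul L) ?_
    · filter_upwards [hIoi] with δ hδ
      exact (integrableOn_damped ha hGc (fun y hy => hGL 0 y le_rfl hy) (α - N)
        (by rwa [hre])).1.1
    · filter_upwards [hIoi] with δ hδ
      filter_upwards [ae_restrict_mem measurableSet_Ioi] with y hy
      have hy0 : 0 < y := ha.trans hy
      have h2 : 0 ≤ y ^ (α - N) := Real.rpow_nonneg hy0.le _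
      rw [norm_mul, norm_mul, Complex.norm_real, Real.norm_of_nonneg h2]
      calc y ^ (α - N) * ‖G 0 y‖ * ‖Complex.exp (-(ρ δ) * y)‖ ≤ y ^ (α - N) * L * 1 := by
            gcongr
            · exact hGL 0 y le_rfl (Ioi_subset_Ici_self hy)
            · exact hexp1 δ y hδ hy0.le
        _ = L * y ^ (α - N) := by ring
    · exact Eventually.of_forall fun y => (hexp y).const_mul _
  have t2 : Tendsto (fun δ => ∫ y in (0 : ℝ)..a, ((y ^ α : ℝ) : ℂ) *
      Complex.exp (-(ρ δ) * y)) (𝓝[>] 0) (𝓝 (∫ y in (0 : ℝ)..a, ((y ^ α : ℝ) : ℂ) *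
        Complex.exp (-(2 * Complex.I) * y))) := by
    refine intervalIntegral.tendsto_integral_filter_of_dominated_convergence
      (fun y => y ^ α) ?_ ?_ (hcont.intervalIntegrable _ _) ?_
    · exact Eventually.of_forall fun δ => Continuous.aestronglyMeasurable (by fun_prop)
    · filter_upwards [hIoi] with δ hδ
      refine Eventually.of_forall fun y hy => ?_
      rw [uIoc_of_le ha.le] at hy
      have h2 : 0 ≤ y ^ α := Real.rpow_nonneg hy.1.le _
      rw [norm_mul, Complex.norm_real, Real.norm_of_nonneg h2]
      exact mul_le_of_le_one_right h2 (hexp1 δ y hδ hy.1.le)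
    · exact Eventually.of_forall fun y _ => (hexp y).const_mul _
  have t3 : Tendsto (fun δ : ℝ => (δ : ℂ) * (∫ y in Ioi a, ((y ^ α : ℝ) : ℂ) * q 0 y *
      Complex.exp (-(ρ δ) * y))) (𝓝[>] 0) (𝓝 0) := by
    have hlim : Tendsto (fun δ : ℝ => δ * C) (𝓝[>] 0) (𝓝 0) := by
      have : Tendsto (fun δ : ℝ => δ * C) (𝓝 0) (𝓝 (0 * C)) :=
        Continuous.tendsto (by fun_prop) 0
      rw [zero_mul] at this
      exact tendsto_nhdsWithin_of_tendsto_nhds this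
    refine squeeze_zero_norm' ?_ hlim
    filter_upwards [hIoi] with δ hδ
    rw [norm_mul, Complex.norm_real, Real.norm_of_nonneg hδ.le]
    exact mul_le_mul_of_nonneg_left (hC δ hδ) hδ.le
  have t4 : Tendsto (fun δ : ℝ => Real.Gamma (α + 1) / (ρ δ) ^ ((α : ℂ) + 1)) (𝓝[>] 0)
      (𝓝 (Real.Gamma (α + 1) / (2 * Complex.I) ^ ((α : ℂ) + 1))) := by
    have hne : (2 * Complex.I) ^ ((α : ℂ) + 1) ≠ 0 := by simp [Complex.cpow_eq_zero_iff]
    have hs : (2 * Complex.I) ∈ Complex.slitPlane := Or.inr (by simp)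
    have h1 : Tendsto ρ (𝓝[>] 0) (𝓝 (2 * Complex.I)) := by
      rw [← hρ0]
      exact tendsto_nhdsWithin_of_tendsto_nhds (hρc.tendsto 0)
    exact tendsto_const_nhds.div
      (h1.cpow tendsto_const_nhds hs) hne
  have hsum := ((((hexp a).const_mul (((a ^ α : ℝ) : ℂ) * q 0 a)).add t1).add t2).sub t3
  rw [sub_zero] at hsum
  exact tendsto_nhds_unique (hsum.congr' (hIoi.mono fun δ hδ => key δ hδ)) t4

/-! ### Comparison of a solution with an approximate solution on a half-line -/

/-- If `U' = P U` is an approximate solution of `u'' + (1 + θ x ^ α) u = 0` with residual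
`θ x ^ (α - N) g`, then the logarithmic derivative at `a` of an exact solution asymptotic to `U`
is `P a` plus an explicit correction of order `θ`, up to `O(θ ^ 2)`. -/
lemma exists_bound_deriv_sub_of_approx {α a N K : ℝ} (hα : 0 < α) (ha : 0 < a)
    (hN : 2 * α + 2 < N) (hK : 0 ≤ K) {G₀ : ℝ → ℂ} (hG₀c : ContinuousOn G₀ (Ici a))
    (hG₀ : ∀ x ∈ Ici a, ‖G₀ x‖ ≤ K) :
    ∃ C, 0 ≤ C ∧ ∀ (θ : ℝ) (u u' U P g : ℝ → ℂ), 0 ≤ θ →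
      (∀ x ∈ Ici a, HasDerivAt u (u' x) x) →
      (∀ x ∈ Ici a, HasDerivAt u' (-(1 + θ * ((x ^ α : ℝ) : ℂ)) * u x) x) →
      (∀ x ∈ Ici a, HasDerivAt U (P x * U x) x) →
      (∀ x ∈ Ici a, HasDerivAt P (θ * (((x ^ (α - N) : ℝ) : ℂ) * g x) - P x ^ 2 -
        (1 + θ * ((x ^ α : ℝ) : ℂ))) x) →
      ContinuousOn g (Ici a) →
      (∀ x ∈ Ici a, ‖g x‖ ≤ K) → (∀ x ∈ Ici a, ‖g x - G₀ x‖ ≤ K * (θ * x ^ α)) →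
      (∀ x ∈ Ici a, ‖P x + Complex.I‖ ≤ K * (θ * x ^ α)) →
      (∀ x ∈ Ici a, U x ≠ 0) → (∀ x ∈ Ici a, ‖U x‖ ≤ K) →
      (∀ x ∈ Ici a, ‖(U x)⁻¹‖ ^ 2 ≤ K * x ^ α) → (∀ x ∈ Ici a, ‖u x‖ ≤ K) →
      Tendsto (fun x => u' x * U x - u x * (P x * U x)) atTop (𝓝 0) →
      ‖u' a - u a * (P a + θ * ∫ y in Ioi a, ((y ^ (α - N) : ℝ) : ℂ) * G₀ y *
        Complex.exp (-(2 * Complex.I) * (y - a)))‖ ≤ C * θ ^ 2 := by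
  have hx0 : ∀ x ∈ Ici a, 0 < x := fun x hx => ha.trans_le hx
  have hpos : ∀ β : ℝ, ∀ x ∈ Ici a, 0 < x ^ β := fun β x hx => Real.rpow_pos_of_pos (hx0 x hx) β
  have hrc : ∀ β : ℝ, ContinuousOn (fun x : ℝ => ((x ^ β : ℝ) : ℂ)) (Ici a) := fun β =>
    Complex.continuous_ofReal.comp_continuousOn fun x hx =>
      (Real.continuousAt_rpow_const x β (Or.inl (hx0 x hx).ne')).continuousWithinAt
  set C₁ : ℝ := K ^ 3 / (-(α - N + 1)) with hC₁
  have hC₁0 : 0 ≤ C₁ := div_nonneg (by positivity) (by linarith)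
  set C₂ : ℝ := C₁ * K * (a ^ (2 * α - N + 1 + 1) / (-(2 * α - N + 1 + 1))) with hC₂
  have hC₂0 : 0 ≤ C₂ := by
    have := hpos (2 * α - N + 1 + 1) a self_mem_Ici
    have h : 0 < -(2 * α - N + 1 + 1) := by linarith
    positivity
  set L : ℝ := 1 + K * a ^ α with hL
  have hL0 : 0 ≤ L := by
    have := hpos α a self_mem_Ici
    positivity
  set C₃ : ℝ := K ^ 2 / (α + 1) with hC₃
  have hC₃0 : 0 ≤ C₃ := by positivity
  set C₄ : ℝ := K ^ 2 * C₂ / a ^ (α + 1) + 2 * K ^ 2 * L * C₃ with hC₄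
  have hC₄0 : 0 ≤ C₄ := by
    have := hpos (α + 1) a self_mem_Ici
    positivity
  set C₅ : ℝ := K ^ 3 / a + K * C₄ with hC₅
  have hC₅0 : 0 ≤ C₅ := by positivity
  set C₆ : ℝ := C₅ * (a ^ (2 * α + 1 - N + 1) / (-(2 * α + 1 - N + 1))) with hC₆
  have hC₆0 : 0 ≤ C₆ := by
    have := hpos (2 * α + 1 - N + 1) a self_mem_Ici
    have h : 0 < -(2 * α + 1 - N + 1) := by linarith
    positivity
  refine ⟨C₆ * L, by positivity, ?_⟩
  intro θ u u' U P g hθ hu hu' hU hP hgc hg hgG hPI hU0 hUK hUinv huK hW0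
  have haa : a ∈ Ici a := self_mem_Ici
  -- the Wronskian
  have hW : ∀ x ∈ Ici a, HasDerivAt (fun x => u' x * U x - u x * (P x * U x))
      (-(θ * (((x ^ (α - N) : ℝ) : ℂ) * (g x * (u x * U x))))) x := by
    intro x hx
    refine (((hu' x hx).mul (hU x hx)).sub
      ((hu x hx).mul ((hP x hx).mul (hU x hx)))).congr_deriv ?_
    simp only [Pi.mul_apply]
    ring
  have huU : ∀ x ∈ Ici a, ‖u x * U x‖ ≤ K ^ 2 := by
    intro x hx
    rw [norm_mul, sq]
    exact mul_le_mul (huK x hx) (hUK x hx) (norm_nonneg _) hK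
  have hW' : ∀ x ∈ Ici a, ‖-(θ * (((x ^ (α - N) : ℝ) : ℂ) * (g x * (u x * U x))))‖ ≤
      θ * K ^ 3 * x ^ (α - N) := by
    intro x hx
    rw [norm_neg, norm_mul, norm_mul, Complex.norm_real, Complex.norm_real,
      Real.norm_of_nonneg hθ, Real.norm_of_nonneg (hpos _ x hx).le, norm_mul]
    have := hpos (α - N) x hx
    calc θ * (x ^ (α - N) * (‖g x‖ * ‖u x * U x‖)) ≤ θ * (x ^ (α - N) * (K * K ^ 2)) := by
          gcongr
          · exact hg x hx
          · exact huU x hx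
      _ = θ * K ^ 3 * x ^ (α - N) := by ring
  have hWle : ∀ x ∈ Ici a, ‖u' x * U x - u x * (P x * U x)‖ ≤ θ * C₁ * x ^ (α - N + 1) := by
    intro x hx
    have := norm_le_of_norm_deriv_le_rpow_of_tendsto (C := θ * K ^ 3) (β := α - N) (x := x)
      (by linarith) (by positivity) (hx0 x hx) (fun t ht => hW t (Ici_subset_Ici.2 hx ht))
      (fun t ht => hW' t (Ici_subset_Ici.2 hx ht)) hW0
    refine this.trans_eq ?_
    rw [hC₁]
    ring
  -- the quotient
  have hV : ∀ x ∈ Ici a, HasDerivAt (fun x => u x * (U x)⁻¹)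
      ((u' x * U x - u x * (P x * U x)) * (U x)⁻¹ ^ 2) x := by
    intro x hx
    refine ((hu x hx).mul ((hU x hx).inv (hU0 x hx))).congr_deriv ?_
    have := hU0 x hx
    simp only [Pi.inv_apply]
    field_simp
    ring
  have hV' : ∀ x ∈ Ici a, ‖(u' x * U x - u x * (P x * U x)) * (U x)⁻¹ ^ 2‖ ≤
      θ * (C₁ * K) * x ^ (2 * α - N + 1) := by
    intro x hx
    rw [norm_mul, norm_pow]
    calc ‖u' x * U x - u x * (P x * U x)‖ * ‖(U x)⁻¹‖ ^ 2
        ≤ (θ * C₁ * x ^ (α - N + 1)) * (K * x ^ α) := by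
          have := hpos (α - N + 1) x hx
          gcongr
          · exact hWle x hx
          · exact hUinv x hx
      _ = θ * (C₁ * K) * (x ^ (α - N + 1) * x ^ α) := by ring
      _ = θ * (C₁ * K) * x ^ (2 * α - N + 1) := by
          rw [← Real.rpow_add (hx0 x hx)]
          ring_nf
  set μ : ℂ := u a * (U a)⁻¹ with hμ
  have hVle : ∀ x ∈ Ici a, ‖u x - μ * U x‖ ≤ θ * (K * C₂) := by
    intro x hx
    have h := norm_sub_le_of_norm_deriv_le_rpow_of_lt (C := θ * (C₁ * K)) (x := a) (y := x)
      (β := 2 * α - N + 1) (by linarith) (by positivity) ha hx (fun t ht => hV t ht.1)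
      (fun t ht => hV' t ht.1)
    have h2 : u x - μ * U x = (u x * (U x)⁻¹ - u a * (U a)⁻¹) * U x := by
      rw [sub_mul, mul_assoc (u x), inv_mul_cancel₀ (hU0 x hx), mul_one]
    rw [h2, norm_mul]
    calc _ ≤ (θ * (C₁ * K) * (a ^ (2 * α - N + 1 + 1) / (-(2 * α - N + 1 + 1)))) * K :=
          mul_le_mul h (hUK x hx) (norm_nonneg _) ((norm_nonneg _).trans h)
      _ = θ * (K * C₂) := by rw [hC₂]; ring
  -- the approximate solution is close to a plane wave
  set e : ℝ → ℂ := fun x => Complex.exp (-Complex.I * (x - a)) with he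
  have he1 : ∀ x : ℝ, ‖e x‖ = 1 := fun x => by
    rw [he]
    simp only [Complex.norm_exp]
    simp
  have hD : ∀ x ∈ Ici a, HasDerivAt (fun x : ℝ => U x * Complex.exp (Complex.I * (x - a)))
      ((P x + Complex.I) * (U x * Complex.exp (Complex.I * (x - a)))) x := by
    intro x hx
    have h2 : HasDerivAt (fun y : ℝ => Complex.exp (Complex.I * (y - a)))
        (Complex.exp (Complex.I * (x - a)) * (Complex.I * 1)) x :=
      ((((hasDerivAt_id x).ofReal_comp).sub_const (a : ℂ)).const_mul Complex.I).cexp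
    refine ((hU x hx).mul h2).congr_deriv ?_
    ring
  have hnorm : ∀ x : ℝ, ‖Complex.exp (Complex.I * (x - a))‖ = 1 := fun x => by
    simp [Complex.norm_exp]
  have hDle : ∀ x ∈ Ici a, ‖U x - U a * e x‖ ≤ θ * C₃ * x ^ (α + 1) := by
    intro x hx
    have h := norm_sub_le_of_norm_deriv_le_rpow_of_gt (C := θ * K ^ 2) (x := a) (y := x)
      (β := α) (by linarith) (by positivity) ha hx (fun t ht => hD t ht.1) (fun t ht => ?_)
    · have h2 : U x - U a * e x = (U x * Complex.exp (Complex.I * (x - a)) -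
          U a * Complex.exp (Complex.I * (a - a))) * e x := by
        rw [sub_mul, mul_assoc, he]
        simp only
        rw [← Complex.exp_add]
        simp
      rw [h2, norm_mul, he1, mul_one]
      refine h.trans_eq ?_
      rw [hC₃]
      ring
    · rw [norm_mul, norm_mul, hnorm, mul_one]
      calc _ ≤ (K * (θ * t ^ α)) * K := by
            have := hpos α t ht.1
            gcongr
            · exact hPI t ht.1
            · exact hUK t ht.1
        _ = _ := by ring
  have hUa : ‖(U a)⁻¹‖ ≤ L := by
    have := hUinv a haa
    nlinarith [sq_nonneg (‖(U a)⁻¹‖ - 1)]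
  have hμK : ‖μ‖ ≤ K * L := by
    rw [hμ, norm_mul]
    exact mul_le_mul (huK a haa) hUa (norm_nonneg _) hK
  have hprod : ∀ x ∈ Ici a, ‖u x * U x - u a * U a * (e x) ^ 2‖ ≤ θ * C₄ * x ^ (α + 1) := by
    intro x hx
    have h1 : u a * U a = μ * U a ^ 2 := by
      have := hU0 a haa
      rw [hμ]
      field_simp
    have h2 : u x * U x - u a * U a * (e x) ^ 2 =
        (u x - μ * U x) * U x + μ * ((U x - U a * e x) * (U x + U a * e x)) := by
      rw [h1]
      ring
    rw [h2]
    have h3 : ‖U x + U a * e x‖ ≤ K + K :=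
      norm_add_le_of_le (hUK x hx) (by rw [norm_mul, he1, mul_one]; exact hUK a haa)
    have h4 : 1 ≤ x ^ (α + 1) / a ^ (α + 1) := by
      rw [one_le_div (hpos _ a haa)]
      exact Real.rpow_le_rpow ha.le hx (by linarith)
    have h5 := hpos (α + 1) x hx
    have h6 : ‖(u x - μ * U x) * U x‖ ≤ θ * (K * C₂) * K * (x ^ (α + 1) / a ^ (α + 1)) := by
      rw [norm_mul]
      calc _ ≤ (θ * (K * C₂)) * K :=
            mul_le_mul (hVle x hx) (hUK x hx) (norm_nonneg _) (by positivity)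
        _ ≤ _ := le_mul_of_one_le_right (by positivity) h4
    have h7 : ‖μ * ((U x - U a * e x) * (U x + U a * e x))‖ ≤
        (K * L) * ((θ * C₃ * x ^ (α + 1)) * (K + K)) := by
      rw [norm_mul μ, norm_mul (U x - U a * e x)]
      exact mul_le_mul hμK (mul_le_mul (hDle x hx) h3 (norm_nonneg _) (by positivity))
        (by positivity) (by positivity)
    refine (norm_add_le_of_le h6 h7).trans_eq ?_
    rw [hC₄]
    ring
  have hdiff : ∀ x ∈ Ici a, ‖g x * (u x * U x) - G₀ x * (u a * U a * (e x) ^ 2)‖ ≤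
      θ * C₅ * x ^ (α + 1) := by
    intro x hx
    have h1 : g x * (u x * U x) - G₀ x * (u a * U a * (e x) ^ 2) =
        (g x - G₀ x) * (u x * U x) + G₀ x * (u x * U x - u a * U a * (e x) ^ 2) := by ring
    rw [h1]
    have h5 := hpos α x hx
    have h2 : ‖(g x - G₀ x) * (u x * U x)‖ ≤ (K * (θ * x ^ α)) * K ^ 2 * (x / a) := by
      rw [norm_mul]
      have : 1 ≤ x / a := by rwa [one_le_div ha]
      calc _ ≤ (K * (θ * x ^ α)) * K ^ 2 :=
            mul_le_mul (hgG x hx) (huU x hx) (norm_nonneg _) (by positivity)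
        _ ≤ _ := le_mul_of_one_le_right (by positivity) this
    have h3 : ‖G₀ x * (u x * U x - u a * U a * (e x) ^ 2)‖ ≤ K * (θ * C₄ * x ^ (α + 1)) := by
      rw [norm_mul]
      exact mul_le_mul (hG₀ x hx) (hprod x hx) (norm_nonneg _) hK
    refine (norm_add_le_of_le h2 h3).trans_eq ?_
    rw [hC₅, Real.rpow_add_one (hx0 x hx).ne']
    ring
  -- integration of the Wronskian identity
  have hec : Continuous e := by fun_prop
  have huc : ContinuousOn u (Ici a) := fun x hx => (hu x hx).continuousAt.continuousWithinAt
  have hUc : ContinuousOn U (Ici a) := fun x hx => (hU x hx).continuousAt.continuousWithinAt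
  have i1 : IntegrableOn (fun x : ℝ => ((x ^ (α - N) : ℝ) : ℂ) * (g x * (u x * U x))) (Ioi a) := by
    refine integrableOn_Ioi_of_norm_le_rpow (C := K ^ 3) (β := α - N) (by linarith) ha
      ((hrc _).mul (hgc.mul (huc.mul hUc))) fun x hx => ?_
    rw [norm_mul, Complex.norm_real, Real.norm_of_nonneg (hpos _ x hx).le, norm_mul]
    have := hpos (α - N) x hx
    calc _ ≤ x ^ (α - N) * (K * K ^ 2) := by
          gcongr
          · exact hg x hx
          · exact huU x hx
      _ = _ := by ring
  have i2 : IntegrableOn (fun x : ℝ => ((x ^ (α - N) : ℝ) : ℂ) * (G₀ x * (u a * U a * (e x) ^ 2)))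
      (Ioi a) := by
    refine integrableOn_Ioi_of_norm_le_rpow (C := K ^ 3) (β := α - N) (by linarith) ha
      ((hrc _).mul (hG₀c.mul (continuousOn_const.mul (hec.pow 2).continuousOn))) fun x hx => ?_
    rw [norm_mul, Complex.norm_real, Real.norm_of_nonneg (hpos _ x hx).le, norm_mul, norm_mul,
      norm_pow, he1, one_pow, mul_one]
    have := hpos (α - N) x hx
    calc _ ≤ x ^ (α - N) * (K * K ^ 2) := by
          gcongr
          · exact hG₀ x hx
          · exact huU a haa
      _ = _ := by ring
  have hWa := integral_Ioi_of_hasDerivAt_of_tendsto' hW ((i1.const_mul (θ : ℂ)).neg) hW0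
  rw [integral_neg, integral_const_mul] at hWa
  have hJ : ∫ x in Ioi a, ((x ^ (α - N) : ℝ) : ℂ) * (G₀ x * (u a * U a * (e x) ^ 2)) =
      u a * U a * ∫ y in Ioi a, ((y ^ (α - N) : ℝ) : ℂ) * G₀ y *
        Complex.exp (-(2 * Complex.I) * (y - a)) := by
    rw [← integral_const_mul]
    refine integral_congr_ae (Eventually.of_forall fun y => ?_)
    simp only [he]
    rw [← Complex.exp_nat_mul]
    push_cast
    ring_nf
  have hsub := integral_sub i1 i2
  have hbound : ‖∫ x in Ioi a, (((x ^ (α - N) : ℝ) : ℂ) * (g x * (u x * U x)) -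
      ((x ^ (α - N) : ℝ) : ℂ) * (G₀ x * (u a * U a * (e x) ^ 2)))‖ ≤ θ * C₆ := by
    have := norm_integral_Ioi_le_of_norm_le_rpow (a := a) (C := θ * C₅) (β := 2 * α + 1 - N)
      (f := fun x : ℝ => ((x ^ (α - N) : ℝ) : ℂ) * (g x * (u x * U x)) -
        ((x ^ (α - N) : ℝ) : ℂ) * (G₀ x * (u a * U a * (e x) ^ 2))) (by linarith) ha ?_
    · refine this.trans_eq ?_
      rw [hC₆]
      ring
    · intro x hx
      have hx := Ioi_subset_Ici_self hx
      rw [← mul_sub, norm_mul, Complex.norm_real, Real.norm_of_nonneg (hpos _ x hx).le]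
      calc _ ≤ x ^ (α - N) * (θ * C₅ * x ^ (α + 1)) :=
            mul_le_mul_of_nonneg_left (hdiff x hx) (hpos _ x hx).le
        _ = θ * C₅ * (x ^ (α - N) * x ^ (α + 1)) := by ring
        _ = _ := by
            rw [← Real.rpow_add (hx0 x hx)]
            ring_nf
  rw [hsub, hJ] at hbound
  set J := ∫ y in Ioi a, ((y ^ (α - N) : ℝ) : ℂ) * G₀ y *
    Complex.exp (-(2 * Complex.I) * (y - a)) with hJdef
  set I₁ := ∫ x in Ioi a, ((x ^ (α - N) : ℝ) : ℂ) * (g x * (u x * U x)) with hI₁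
  have hfin : u' a - u a * (P a + θ * J) = θ * (I₁ - u a * U a * J) * (U a)⁻¹ := by
    rw [eq_mul_inv_iff_mul_eq₀ (hU0 a haa)]
    linear_combination hWa
  rw [hfin, norm_mul, norm_mul, Complex.norm_real, Real.norm_of_nonneg hθ]
  calc _ ≤ θ * (θ * C₆) * L := by gcongr
    _ = _ := by ring

/-! ### Amplitude, phase and the WKB waves -/

lemma one_sub_spd_sq_le_rpow (α : ℝ) {θ x γ : ℝ} (hθ : 0 ≤ θ) (hx : 0 < x) (hγ : 0 < γ)
    (hγ1 : γ ≤ 1) : 1 - spd α θ x ^ 2 ≤ θ ^ γ * x ^ (α * γ) := by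
  have h0 := one_sub_spd_sq_nonneg α hθ x
  have h1 : 1 - spd α θ x ^ 2 ≤ 1 := by nlinarith [spd_pos α hθ x]
  have hr := Real.rpow_nonneg hx.le α
  calc 1 - spd α θ x ^ 2 = (1 - spd α θ x ^ 2) ^ (1 : ℝ) := (Real.rpow_one _).symm
    _ ≤ (1 - spd α θ x ^ 2) ^ γ := Real.rpow_le_rpow_of_exponent_ge' h0 h1 hγ.le hγ1
    _ ≤ (θ * x ^ α) ^ γ := Real.rpow_le_rpow h0 (one_sub_spd_sq_le α hθ hx) hγ.le
    _ = θ ^ γ * x ^ (α * γ) := by rw [Real.mul_rpow hθ hr, ← Real.rpow_mul hx.le]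

lemma amp_pos (α : ℝ) {θ : ℝ} (hθ : 0 ≤ θ) (x : ℝ) : 0 < amp α θ x :=
  Real.rpow_pos_of_pos (spd_pos α hθ x) _

lemma amp_sq (α : ℝ) {θ : ℝ} (hθ : 0 ≤ θ) (x : ℝ) : amp α θ x ^ 2 = spd α θ x := by
  rw [amp, ← Real.rpow_natCast, ← Real.rpow_mul (spd_pos α hθ x).le]
  norm_num

lemma amp_le_one (α : ℝ) {θ : ℝ} (hθ : 0 ≤ θ) (x : ℝ) : amp α θ x ≤ 1 :=
  Real.rpow_le_one (spd_pos α hθ x).le (spd_le_one α hθ x) (by norm_num)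

lemma hasDerivAt_amp (α : ℝ) {θ x : ℝ} (hθ : 0 ≤ θ) (hx : 0 < x) :
    HasDerivAt (amp α θ) (-(α / 4) * (1 - spd α θ x ^ 2) / x * amp α θ x) x := by
  have hs := spd_pos α hθ x
  refine ((hasDerivAt_spd α hθ hx).rpow_const (p := 1 / 2) (Or.inl hs.ne')).congr_deriv ?_
  rw [Real.rpow_sub_one hs.ne', amp]
  field_simp
  ring

lemma hasDerivAt_phase {α θ : ℝ} (hα : 0 < α) (hθ : 0 ≤ θ) (x : ℝ) :
    HasDerivAt (phase α θ) (spd α θ x)⁻¹ x := by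
  have hc : Continuous fun y => (spd α θ y)⁻¹ :=
    (continuous_spd hα hθ).inv₀ fun y => (spd_pos α hθ y).ne'
  exact intervalIntegral.integral_hasDerivAt_right (hc.intervalIntegrable _ _)
    (hc.stronglyMeasurableAtFilter _ _) hc.continuousAt

lemma continuous_phase {α θ : ℝ} (hα : 0 < α) (hθ : 0 ≤ θ) : Continuous (phase α θ) :=
  continuous_iff_continuousAt.2 fun x => (hasDerivAt_phase hα hθ x).continuousAt

lemma hasDerivAt_vplus {α θ x : ℝ} (hα : 0 < α) (hθ : 0 ≤ θ) (hx : 0 < x) :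
    HasDerivAt (vplus α θ) ((-(α / 4) * (1 - (spd α θ x : ℂ) ^ 2) / x -
      Complex.I * (spd α θ x : ℂ)⁻¹) * vplus α θ x) x := by
  have h1 := (hasDerivAt_amp α hθ hx).ofReal_comp
  have h2 := ((hasDerivAt_phase hα hθ x).ofReal_comp.const_mul (-Complex.I)).cexp
  refine (h1.mul h2).congr_deriv ?_
  rw [vplus]
  push_cast
  ring

lemma hasDerivAt_vminus {α θ x : ℝ} (hα : 0 < α) (hθ : 0 ≤ θ) (hx : 0 < x) :
    HasDerivAt (vminus α θ) ((-(α / 4) * (1 - (spd α θ x : ℂ) ^ 2) / x +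
      Complex.I * (spd α θ x : ℂ)⁻¹) * vminus α θ x) x := by
  have h1 := (hasDerivAt_amp α hθ hx).ofReal_comp
  have h2 := ((hasDerivAt_phase hα hθ x).ofReal_comp.const_mul Complex.I).cexp
  refine (h1.mul h2).congr_deriv ?_
  rw [vminus]
  push_cast
  ring

lemma norm_vplus (α : ℝ) {θ : ℝ} (hθ : 0 ≤ θ) (x : ℝ) : ‖vplus α θ x‖ = amp α θ x := by
  rw [vplus, norm_mul, Complex.norm_real, Real.norm_of_nonneg (amp_pos α hθ x).le,
    Complex.norm_exp]
  simp

lemma norm_vminus (α : ℝ) {θ : ℝ} (hθ : 0 ≤ θ) (x : ℝ) : ‖vminus α θ x‖ = amp α θ x := by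
  rw [vminus, norm_mul, Complex.norm_real, Real.norm_of_nonneg (amp_pos α hθ x).le,
    Complex.norm_exp]
  simp

lemma Mfun_eq (α : ℝ) {θ x : ℝ} (hθ : 0 ≤ θ) (hx : 0 < x) :
    Mfun α θ x = spd α θ x * (1 - spd α θ x ^ 2) / x ^ 2 *
      (α ^ 2 / 16 * (1 - spd α θ x ^ 2) + α / 4 - α ^ 2 / 4 * spd α θ x ^ 2) := by
  have h1 : deriv (amp α θ) =ᶠ[𝓝 x]
      fun y => -(α / 4) * (1 - spd α θ y ^ 2) / y * amp α θ y := by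
    filter_upwards [lt_mem_nhds hx] with y hy using (hasDerivAt_amp α hθ hy).deriv
  have h2 := ((((hasDerivAt_spd α hθ hx).pow 2).const_sub 1).const_mul (-(α / 4))).div
    (hasDerivAt_id x) hx.ne'
  have h3 := (h2.mul (hasDerivAt_amp α hθ hx)).congr_of_eventuallyEq h1
  have h4 := h3.deriv
  rw [Mfun, if_pos hx]
  change amp α θ x * deriv (deriv (amp α θ)) x = _
  rw [h4, ← amp_sq α hθ x]
  simp only [id, Pi.div_apply, Pi.pow_apply]
  rw [← amp_sq α hθ x]
  field_simp
  ring

lemma continuousOn_Mfun {α θ : ℝ} (hα : 0 < α) (hθ : 0 ≤ θ) :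
    ContinuousOn (Mfun α θ) (Ioi 0) := by
  have hs := (continuous_spd hα hθ).continuousOn (s := Ioi 0)
  refine ContinuousOn.congr (f := fun x => spd α θ x * (1 - spd α θ x ^ 2) / x ^ 2 *
    (α ^ 2 / 16 * (1 - spd α θ x ^ 2) + α / 4 - α ^ 2 / 4 * spd α θ x ^ 2)) ?_
    fun x hx => Mfun_eq α hθ hx
  refine ContinuousOn.mul (ContinuousOn.div (by fun_prop) (by fun_prop) fun x hx => ?_)
    (by fun_prop)
  exact pow_ne_zero 2 (ne_of_gt hx)

lemma abs_Mfun_le {α θ x γ : ℝ} (hα : 0 < α) (hθ : 0 ≤ θ) (hx : 0 < x) (hγ : 0 < γ)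
    (hγ1 : γ ≤ 1) : |Mfun α θ x| ≤ (α ^ 2 + α) * θ ^ γ * x ^ (α * γ - 2) := by
  have hs0 := spd_pos α hθ x
  have hs1 := spd_le_one α hθ x
  have hh0 := one_sub_spd_sq_nonneg α hθ x
  have hsq : 0 ≤ spd α θ x ^ 2 := sq_nonneg _
  have h1 : |α ^ 2 / 16 * (1 - spd α θ x ^ 2) + α / 4 - α ^ 2 / 4 * spd α θ x ^ 2| ≤
      α ^ 2 + α := by
    rw [abs_le]
    constructor <;> nlinarith [mul_nonneg (sq_nonneg α) hh0, mul_nonneg (sq_nonneg α) hsq]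
  have h2 : spd α θ x * (1 - spd α θ x ^ 2) / x ^ 2 ≤ θ ^ γ * x ^ (α * γ - 2) := by
    have h3 := one_sub_spd_sq_le_rpow α hθ hx hγ hγ1
    rw [Real.rpow_sub hx, Real.rpow_two, ← mul_div_assoc]
    exact div_le_div_of_nonneg_right ((mul_le_of_le_one_left hh0 hs1).trans h3) (sq_nonneg x)
  rw [Mfun_eq α hθ hx, abs_mul, abs_of_nonneg (by positivity)]
  calc _ ≤ (θ ^ γ * x ^ (α * γ - 2)) * (α ^ 2 + α) :=
        mul_le_mul h2 h1 (abs_nonneg _) (le_trans (by positivity) h2)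
    _ = _ := by ring

/-! ### The approximate solution -/

/-- The logarithmic derivative of the approximate solution, with correction profile `H`. -/
def wkbLogDeriv (α : ℝ) (H : ℝ → ℝ → ℂ) (θ x : ℝ) : ℂ :=
  -Complex.I * (spd α θ x : ℂ)⁻¹ +
    (x : ℂ)⁻¹ * (1 - (spd α θ x : ℂ) ^ 2) * (-α / 4 + spd α θ x * (x : ℂ)⁻¹ * H θ x)

lemma hasDerivAt_wkbLogDeriv {α θ x : ℝ} (n : ℕ) (hθ : 0 ≤ θ) (hx : 0 < x)
    {H H' G : ℝ → ℝ → ℂ} (hder : HasDerivAt (H θ) (H' θ x / x) x)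
    (hid : ∀ s ε k : ℂ, s = spd α θ x → ε = s * (x : ℂ)⁻¹ → k = -α / 4 + ε * H θ x →
      -Complex.I * α / 2 - 2 * Complex.I * k +
        ε * (ε * (H' θ x - (1 + α / 2 * (1 - s ^ 2)) * H θ x) +
          (α - 1 - α * (1 - s ^ 2)) * k + (1 - s ^ 2) * k ^ 2) = ε ^ (n + 1) * G θ x) :
    HasDerivAt (wkbLogDeriv α H θ)
      (θ * (((x ^ (α - (n + 2)) : ℝ) : ℂ) * ((spd α θ x : ℂ) ^ (n + 2) * G θ x)) -
        wkbLogDeriv α H θ x ^ 2 - (1 + θ * ((x ^ α : ℝ) : ℂ))) x := by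
  have hs0 := spd_pos α hθ x
  have hs1 : (spd α θ x : ℂ) ≠ 0 := by exact_mod_cast hs0.ne'
  have hx1 : (x : ℂ) ≠ 0 := by exact_mod_cast hx.ne'
  have hsd := (hasDerivAt_spd α hθ hx).ofReal_comp
  have hxd := (hasDerivAt_inv hx.ne').ofReal_comp
  simp only [Complex.ofReal_inv] at hxd
  have h1 := ((hsd.inv hs1).const_mul (-Complex.I)).add
    ((hxd.mul ((hsd.pow 2).const_sub 1)).mul
      (((hsd.mul hxd).mul hder).const_add (-α / 4 : ℂ)))
  have hq : (spd α θ x : ℂ) ^ 2 * (1 + θ * ((x ^ α : ℝ) : ℂ)) = 1 := by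
    exact_mod_cast spd_sq_mul α hθ hx
  have hpow : ((x ^ (α - (n + 2)) : ℝ) : ℂ) = ((x ^ α : ℝ) : ℂ) * (x : ℂ)⁻¹ ^ (n + 2) := by
    rw [Real.rpow_sub hx]
    have : x ^ ((n : ℝ) + 2) = x ^ (n + 2) := by
      rw [← Real.rpow_natCast]
      push_cast
      rfl
    rw [this]
    push_cast
    rw [div_eq_mul_inv, inv_pow]
  have hid' := hid _ _ _ rfl rfl rfl
  refine h1.congr_deriv ?_
  simp only [Pi.mul_apply, Pi.pow_apply]
  rw [wkbLogDeriv, hpow]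
  push_cast
  generalize hsg : (spd α θ x : ℂ) = s at *
  generalize ((x ^ α : ℝ) : ℂ) = r at *
  generalize (x : ℂ) = z at *
  generalize H θ x = h at *
  generalize H' θ x = h' at *
  generalize G θ x = g at *
  have hq2 : 1 + θ * r = s⁻¹ ^ 2 := by
    field_simp
    linear_combination hq
  have hr : θ * r * s ^ 2 = 1 - s ^ 2 := by linear_combination hq
  have hE : θ * (r * z⁻¹ ^ (n + 2) * (s ^ (n + 2) * g)) =
      (1 - s ^ 2) * s⁻¹ * z⁻¹ * ((s * z⁻¹) ^ (n + 1) * g) := by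
    rw [← hr, mul_pow, pow_succ z⁻¹ (n + 1), pow_succ s (n + 1)]
    linear_combination (-(θ * r * g * s ^ (n + 1) * z⁻¹ ^ (n + 1) * z⁻¹ * s)) * mul_inv_cancel₀ hs1
  rw [hq2, hE, ← hid']
  field_simp
  linear_combination (32 * z ^ 4) * Complex.I_sq

lemma exists_approx_solution {α a : ℝ} (hα : 0 < α) (ha : 0 < a) :
    ∃ N K θ₁ : ℝ, ∃ q ∈ profileAlg α, ∃ G ∈ profileAlg α,
      2 * α + 2 < N ∧ 0 ≤ K ∧ 0 < θ₁ ∧ θ₁ ≤ 1 ∧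
      (∀ x, 0 < x → HasDerivAt (fun y : ℝ => ((y ^ α : ℝ) : ℂ) * q 0 y)
        (2 * Complex.I * (((x ^ α : ℝ) : ℂ) * q 0 x) - ((x ^ α : ℝ) : ℂ) +
          ((x ^ (α - N) : ℝ) : ℂ) * G 0 x) x) ∧
      ∀ θ, 0 < θ → θ < θ₁ → ∃ U P : ℝ → ℂ,
        (∀ x ∈ Ici a, HasDerivAt U (P x * U x) x) ∧
        (∀ x ∈ Ici a, HasDerivAt P (θ * (((x ^ (α - N) : ℝ) : ℂ) * G θ x) - P x ^ 2 -
          (1 + θ * ((x ^ α : ℝ) : ℂ))) x) ∧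
        (∀ x ∈ Ici a, ‖P x + Complex.I‖ ≤ K * (θ * x ^ α)) ∧
        (∀ x ∈ Ici a, U x ≠ 0) ∧ (∀ x ∈ Ici a, ‖U x‖ ≤ K * amp α θ x) ∧
        (∀ x ∈ Ici a, ‖(U x)⁻¹‖ ^ 2 ≤ K * x ^ α) ∧
        (∀ x ∈ Ici a, ‖P x - (-(α / 4) * (1 - (spd α θ x : ℂ) ^ 2) / x -
          Complex.I * (spd α θ x : ℂ)⁻¹)‖ ≤ K / x) ∧
        ‖P a + Complex.I - θ * (((a ^ α : ℝ) : ℂ) * q 0 a)‖ ≤ K * θ ^ 2 := by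
  obtain ⟨n, hn⟩ := exists_nat_gt (2 * α)
  obtain ⟨H, hH, H', hH', G, hG, hder, hid⟩ := exists_wkb_expansion α n
  have hs := spd_mem_profileAlg α
  have hi := inv_mem_profileAlg α
  have hx0 : ∀ x ∈ Ici a, 0 < x := fun x hx => ha.trans_le hx
  set κ : ℝ → ℝ → ℂ := fun θ x =>
    (spd α θ x : ℂ) ^ 2 * (-α / 4 + spd α θ x * (x : ℂ)⁻¹ * H θ x) with hκ
  have hκm : κ ∈ profileAlg α :=
    mul_mem (pow_mem hs 2) (add_mem (const_mem_profileAlg α (-α / 4)) (mul_mem (mul_mem hs hi) hH))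
  set q : ℝ → ℝ → ℂ := fun θ x => -Complex.I / 2 + (x : ℂ)⁻¹ * κ θ x with hq
  have hqm : q ∈ profileAlg α :=
    add_mem (const_mem_profileAlg α (-Complex.I / 2)) (mul_mem hi hκm)
  obtain ⟨B, hB, hHB⟩ := exists_bound_of_mem_profileAlg ha hH
  obtain ⟨D, hD, hκD⟩ := exists_bound_of_mem_profileAlg ha hκm
  obtain ⟨L, hL, hκL⟩ := exists_lipschitz_of_mem_profileAlg ha hκm
  set γ : ℝ := min 1 (1 / (2 * α)) with hγ
  have hγ0 : 0 < γ := lt_min one_pos (by positivity)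
  have hγ1 : γ ≤ 1 := min_le_left _ _
  have hαγ : α * γ ≤ 1 / 2 := by
    calc α * γ ≤ α * (1 / (2 * α)) := mul_le_mul_of_nonneg_left (min_le_right _ _) hα.le
      _ = 1 / 2 := by field_simp
  set E₀ : ℝ := B * (a ^ (α * γ - 2 + 1) / (-(α * γ - 2 + 1))) with hE₀
  have hE₀0 : 0 ≤ E₀ := by
    have h1 : 0 ≤ a ^ (α * γ - 2 + 1) := Real.rpow_nonneg ha.le _
    have h2 : 0 < -(α * γ - 2 + 1) := by linarith
    positivity
  obtain ⟨θ₁, hθ₁0, hθ₁1, hθ₁⟩ : ∃ θ₁ : ℝ, 0 < θ₁ ∧ θ₁ ≤ 1 ∧ θ₁ ^ γ * E₀ ≤ 1 := by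
    have h1 : Tendsto (fun θ : ℝ => θ ^ γ * E₀) (𝓝 0) (𝓝 0) := by
      have := (Real.continuousAt_rpow_const 0 γ (Or.inr hγ0.le)).tendsto.mul_const E₀
      rwa [Real.zero_rpow hγ0.ne', zero_mul] at this
    have h2 : ∀ᶠ θ in 𝓝[>] (0 : ℝ), θ ^ γ * E₀ ≤ 1 ∧ θ ≤ 1 ∧ 0 < θ :=
      ((h1.eventually (ge_mem_nhds one_pos)).filter_mono nhdsWithin_le_nhds).and
        (((ge_mem_nhds (one_pos : (0 : ℝ) < 1)).filter_mono nhdsWithin_le_nhds).and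
          self_mem_nhdsWithin)
    obtain ⟨θ, h⟩ := h2.exists
    exact ⟨θ, h.2.2, h.2.1, h.1⟩
  set e : ℝ := Real.exp 1 with he
  have he0 : 0 < e := Real.exp_pos 1
  have hD' : 0 ≤ a⁻¹ * D := by positivity
  have hr0 : 0 < a ^ α := Real.rpow_pos_of_pos ha α
  have hL' : 0 ≤ a ^ α * (a ^ α + a⁻¹ * (L * a ^ α)) := by positivity
  have hM : 0 ≤ e ^ 2 * ((a ^ α)⁻¹ + 1) := by positivity
  set K : ℝ := 1 + a⁻¹ * D + e + e ^ 2 * ((a ^ α)⁻¹ + 1) + a⁻¹ * B +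
    a ^ α * (a ^ α + a⁻¹ * (L * a ^ α)) with hK
  have haB : 0 ≤ a⁻¹ * B := by positivity
  refine ⟨n + 2, K, θ₁, q, hqm, fun θ x => (spd α θ x : ℂ) ^ (n + 2) * G θ x,
    mul_mem (pow_mem hs (n + 2)) hG, by linarith, by positivity, hθ₁0, hθ₁1, ?_, ?_⟩
  · intro x hx
    have hx1 : (x : ℂ) ≠ 0 := by exact_mod_cast hx.ne'
    have hxd := (hasDerivAt_inv hx.ne').ofReal_comp
    simp only [Complex.ofReal_inv] at hxd
    have h1 : q 0 = fun y : ℝ => -Complex.I / 2 + (y : ℂ)⁻¹ * (-α / 4 + (y : ℂ)⁻¹ * H 0 y) := by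
      ext y
      simp [hq, hκ, spd_zero]
    have h2 := (Real.hasDerivAt_rpow_const (p := α) (Or.inl hx.ne')).ofReal_comp
    have h3 := (hxd.mul ((hxd.mul (hder 0 x le_rfl hx)).const_add (-α / 4 : ℂ))).const_add
      (-Complex.I / 2)
    rw [h1]
    refine (h2.mul h3).congr_deriv ?_
    have hid0 := hid 0 x _ _ _ le_rfl hx rfl rfl rfl
    have hpow : ((x ^ (α - (n + 2)) : ℝ) : ℂ) = ((x ^ α : ℝ) : ℂ) * (x : ℂ)⁻¹ ^ (n + 2) := by
      rw [Real.rpow_sub hx]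
      have : x ^ ((n : ℝ) + 2) = x ^ (n + 2) := by
        rw [← Real.rpow_natCast]
        push_cast
        rfl
      rw [this]
      push_cast
      rw [div_eq_mul_inv, inv_pow]
    rw [hpow, Real.rpow_sub_one hx.ne']
    rw [spd_zero] at hid0
    simp only [Pi.mul_apply, spd_zero]
    push_cast at hid0 ⊢
    simp only [one_pow, one_mul] at hid0 ⊢
    linear_combination (((x ^ α : ℝ) : ℂ) * (x : ℂ)⁻¹) * hid0 +
      ((x ^ α : ℝ) : ℂ) * Complex.I_sq
  · intro θ hθ0 hθlt
    have hθ := hθ0.le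
    have hθle : θ ≤ 1 := (hθlt.trans_le hθ₁1).le
    set E' : ℝ → ℂ := fun x => (x : ℂ)⁻¹ * (1 - (spd α θ x : ℂ) ^ 2) *
      (spd α θ x * (x : ℂ)⁻¹ * H θ x) with hE'
    have hE'c : ContinuousOn E' (Ioi 0) := by
      have hm := mul_mem (mul_mem hi (sub_mem (one_mem (profileAlg α)) (pow_mem hs 2)))
        (mul_mem (mul_mem hs hi) hH)
      exact continuousOn_of_mem_profileAlg hθ hm
    have hE : ∀ x ∈ Ici a, HasDerivAt (fun x => ∫ y in a..x, E' y) (E' x) x := by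
      intro x hx
      refine intervalIntegral.integral_hasDerivAt_right
        (ContinuousOn.intervalIntegrable_of_Icc hx (hE'c.mono fun y hy => hx0 y hy.1))
        (hE'c.stronglyMeasurableAtFilter isOpen_Ioi x (hx0 x hx))
        (hE'c.continuousAt (Ioi_mem_nhds (hx0 x hx)))
    have hnorm : ∀ x : ℝ, ‖(1 - (spd α θ x : ℂ) ^ 2)‖ = 1 - spd α θ x ^ 2 := by
      intro x
      have : (1 - (spd α θ x : ℂ) ^ 2) = ((1 - spd α θ x ^ 2 : ℝ) : ℂ) := by push_cast; ring
      rw [this, Complex.norm_real, Real.norm_of_nonneg (one_sub_spd_sq_nonneg α hθ x)]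
    have hsn : ∀ x : ℝ, ‖(spd α θ x : ℂ)‖ = spd α θ x := fun x => by
      rw [Complex.norm_real, Real.norm_of_nonneg (spd_pos α hθ x).le]
    have hxn : ∀ x ∈ Ici a, ‖(x : ℂ)⁻¹‖ = x⁻¹ := fun x hx => by
      rw [norm_inv, Complex.norm_real, Real.norm_of_nonneg (hx0 x hx).le]
    have hE'n : ∀ x ∈ Ici a, ‖E' x‖ = (1 - spd α θ x ^ 2) * spd α θ x * ‖H θ x‖ * (x⁻¹) ^ 2 := by
      intro x hx
      rw [hE']
      simp only
      rw [norm_mul, norm_mul, norm_mul, norm_mul, hnorm, hsn, hxn x hx]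
      ring
    have hEle : ∀ x ∈ Ici a, ‖∫ y in a..x, E' y‖ ≤ 1 := by
      intro x hx
      have h := norm_sub_le_of_norm_deriv_le_rpow_of_lt (C := θ ^ γ * B) (x := a) (y := x)
        (β := α * γ - 2) (by linarith) (by positivity) ha hx (fun t ht => hE t ht.1)
        (fun t ht => ?_)
      · rw [intervalIntegral.integral_same, sub_zero] at h
        refine h.trans ?_
        have h1 : θ ^ γ ≤ θ₁ ^ γ := Real.rpow_le_rpow hθ hθlt.le hγ0.le
        calc _ = θ ^ γ * E₀ := by rw [hE₀]; ring
          _ ≤ θ₁ ^ γ * E₀ := mul_le_mul_of_nonneg_right h1 hE₀0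
          _ ≤ 1 := hθ₁
      · have ht0 := hx0 t ht.1
        have h1 := one_sub_spd_sq_le_rpow α hθ ht0 hγ0 hγ1
        have h2 := one_sub_spd_sq_nonneg α hθ t
        have h3 := spd_pos α hθ t
        rw [hE'n t ht.1, Real.rpow_sub ht0, Real.rpow_two]
        calc (1 - spd α θ t ^ 2) * spd α θ t * ‖H θ t‖ * (t⁻¹) ^ 2
            ≤ (θ ^ γ * t ^ (α * γ)) * 1 * B * (t⁻¹) ^ 2 := by
              have := hHB θ t hθ ht.1
              have := spd_le_one α hθ t
              gcongr
          _ = _ := by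
              rw [inv_pow]
              ring
    set F : ℝ → ℂ := fun x => Complex.exp (∫ y in a..x, E' y) with hF
    have hFle : ∀ x ∈ Ici a, ‖F x‖ ≤ e := by
      intro x hx
      rw [hF]
      simp only
      rw [Complex.norm_exp]
      exact Real.exp_le_exp.2 ((Complex.re_le_norm _).trans (hEle x hx))
    have hFinv : ∀ x ∈ Ici a, ‖(F x)⁻¹‖ ≤ e := by
      intro x hx
      rw [hF]
      simp only
      rw [← Complex.exp_neg, Complex.norm_exp]
      refine Real.exp_le_exp.2 ((Complex.re_le_norm _).trans ?_)
      rw [norm_neg]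
      exact hEle x hx
    have hFne : ∀ x, F x ≠ 0 := fun x => Complex.exp_ne_zero _
    have hvne : ∀ x, vplus α θ x ≠ 0 := fun x => by
      rw [← norm_pos_iff, norm_vplus α hθ]
      exact amp_pos α hθ x
    have hPsplit : ∀ x, wkbLogDeriv α H θ x = (-(α / 4) * (1 - (spd α θ x : ℂ) ^ 2) / x -
          Complex.I * (spd α θ x : ℂ)⁻¹) + E' x := by
      intro x
      rw [wkbLogDeriv, hE']
      ring
    have hPI : ∀ x ∈ Ici a, wkbLogDeriv α H θ x + Complex.I = θ * ((x ^ α : ℝ) : ℂ) *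
        (-Complex.I * (spd α θ x / (1 + spd α θ x)) + (x : ℂ)⁻¹ * κ θ x) := by
      intro x hx
      have hsp := spd_pos α hθ x
      have h1 : (spd α θ x : ℂ) ≠ 0 := by exact_mod_cast hsp.ne'
      have h2 : (1 + spd α θ x : ℂ) ≠ 0 := by exact_mod_cast (by positivity : 1 + spd α θ x ≠ 0)
      have h3 : (1 - (spd α θ x : ℂ) ^ 2) = θ * ((x ^ α : ℝ) : ℂ) * (spd α θ x : ℂ) ^ 2 := by
        exact_mod_cast one_sub_spd_sq α hθ (hx0 x hx)
      have h4 : -Complex.I * (spd α θ x : ℂ)⁻¹ + Complex.I =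
          θ * ((x ^ α : ℝ) : ℂ) * (-Complex.I * (spd α θ x / (1 + spd α θ x))) := by
        field_simp
        linear_combination (-1) * h3
      rw [wkbLogDeriv, hκ]
      simp only
      rw [h3]
      linear_combination h4
    refine ⟨fun x => vplus α θ x * F x, wkbLogDeriv α H θ, ?_, ?_, ?_, ?_, ?_, ?_, ?_, ?_⟩
    · intro x hx
      refine ((hasDerivAt_vplus hα hθ (hx0 x hx)).mul (hE x hx).cexp).congr_deriv ?_
      rw [hPsplit x, hF]
      ring
    · exact fun x hx => hasDerivAt_wkbLogDeriv n hθ (hx0 x hx) (hder θ x hθ (hx0 x hx))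
        fun s ε k => hid θ x s ε k hθ (hx0 x hx)
    · intro x hx
      have hxr := Real.rpow_nonneg (hx0 x hx).le α
      rw [hPI x hx, norm_mul, norm_mul, Complex.norm_real, Complex.norm_real,
        Real.norm_of_nonneg hθ, Real.norm_of_nonneg hxr, mul_comm K]
      refine mul_le_mul_of_nonneg_left ?_ (by positivity)
      have h1 : ‖-Complex.I * (spd α θ x / (1 + spd α θ x) : ℂ)‖ ≤ 1 := by
        have hsp := spd_pos α hθ x
        have h2 : (spd α θ x / (1 + spd α θ x) : ℂ) =
          ((spd α θ x / (1 + spd α θ x) : ℝ) : ℂ) := by push_cast; rfl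
        rw [norm_mul, norm_neg, Complex.norm_I, one_mul, h2, Complex.norm_real,
          Real.norm_of_nonneg (by positivity), div_le_one (by positivity)]
        linarith
      have h2 : ‖(x : ℂ)⁻¹ * κ θ x‖ ≤ a⁻¹ * D := by
        rw [norm_mul, hxn x hx]
        exact mul_le_mul (inv_anti₀ ha hx) (hκD θ x hθ hx) (norm_nonneg _) (by positivity)
      refine (norm_add_le_of_le h1 h2).trans ?_
      rw [hK]
      linarith
    · exact fun x _ => mul_ne_zero (hvne x) (hFne x)
    · intro x hx
      have hap := amp_pos α hθ x
      rw [norm_mul, norm_vplus α hθ, mul_comm]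
      refine mul_le_mul_of_nonneg_right ((hFle x hx).trans ?_) hap.le
      rw [hK]
      linarith
    · intro x hx
      have hap := amp_pos α hθ x
      have hsp := spd_pos α hθ x
      have hxr := Real.rpow_pos_of_pos (hx0 x hx) α
      rw [mul_inv, norm_mul, mul_pow, norm_inv, norm_vplus α hθ, inv_pow, amp_sq α hθ]
      have h1 : (spd α θ x)⁻¹ ≤ 1 + θ * x ^ α := by
        rw [inv_le_iff_one_le_mul₀ hsp]
        have := spd_sq_mul α hθ (hx0 x hx)
        have h2 : 0 ≤ θ * x ^ α := by positivity
        have := spd_le_one α hθ x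
        nlinarith
      have h2 : 1 + θ * x ^ α ≤ ((a ^ α)⁻¹ + 1) * x ^ α := by
        have h3 : 1 ≤ (a ^ α)⁻¹ * x ^ α := by
          rw [inv_mul_eq_div, one_le_div hr0]
          exact Real.rpow_le_rpow ha.le hx hα.le
        nlinarith
      have h3 : ‖(F x)⁻¹‖ ^ 2 ≤ e ^ 2 := pow_le_pow_left₀ (norm_nonneg _) (hFinv x hx) 2
      calc _ ≤ (((a ^ α)⁻¹ + 1) * x ^ α) * e ^ 2 :=
            mul_le_mul (h1.trans h2) h3 (by positivity) (by positivity)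
        _ = (e ^ 2 * ((a ^ α)⁻¹ + 1)) * x ^ α := by ring
        _ ≤ K * x ^ α := by
            refine mul_le_mul_of_nonneg_right ?_ hxr.le
            rw [hK]
            linarith
    · intro x hx
      rw [hPsplit x, add_sub_cancel_left, hE'n x hx]
      have h1 := one_sub_spd_sq_nonneg α hθ x
      have h2 := spd_pos α hθ x
      have h3 := spd_le_one α hθ x
      have h4 := hx0 x hx
      calc (1 - spd α θ x ^ 2) * spd α θ x * ‖H θ x‖ * (x⁻¹) ^ 2
          ≤ 1 * 1 * B * (a⁻¹ * x⁻¹) := by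
            rw [sq (x⁻¹)]
            have h5 : 1 - spd α θ x ^ 2 ≤ 1 := by nlinarith
            have h6 := hHB θ x hθ hx
            have h7 : x⁻¹ ≤ a⁻¹ := inv_anti₀ ha hx
            gcongr
        _ = (a⁻¹ * B) * x⁻¹ := by ring
        _ ≤ K / x := by
            rw [div_eq_mul_inv]
            refine mul_le_mul_of_nonneg_right ?_ (by positivity)
            rw [hK]
            linarith
    · have haa : a ∈ Ici a := self_mem_Ici
      have hsp := spd_pos α hθ a
      have h2 : (1 + spd α θ a : ℂ) ≠ 0 := by exact_mod_cast (by positivity : 1 + spd α θ a ≠ 0)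
      have h1 : wkbLogDeriv α H θ a + Complex.I - θ * (((a ^ α : ℝ) : ℂ) * q 0 a) =
          θ * ((a ^ α : ℝ) : ℂ) * (Complex.I * ((1 - spd α θ a) / (2 * (1 + spd α θ a))) +
            (a : ℂ)⁻¹ * (κ θ a - κ 0 a)) := by
        rw [hPI a haa, hq]
        simp only
        field_simp
        ring
      have h3 : ‖Complex.I * ((1 - spd α θ a) / (2 * (1 + spd α θ a)) : ℂ)‖ ≤ θ * a ^ α := by
        have h4 : ((1 - spd α θ a) / (2 * (1 + spd α θ a)) : ℂ) =
          (((1 - spd α θ a) / (2 * (1 + spd α θ a)) : ℝ) : ℂ) := by push_cast; rfl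
        have h5 : 0 ≤ 1 - spd α θ a := by linarith [spd_le_one α hθ a]
        rw [norm_mul, Complex.norm_I, one_mul, h4, Complex.norm_real,
          Real.norm_of_nonneg (by positivity)]
        refine le_trans ?_ (one_sub_spd_le α hθ ha)
        exact div_le_self h5 (by linarith)
      have h4 : ‖(a : ℂ)⁻¹ * (κ θ a - κ 0 a)‖ ≤ a⁻¹ * (L * (θ * a ^ α)) := by
        rw [norm_mul, hxn a haa]
        exact mul_le_mul_of_nonneg_left (hκL θ a hθ le_rfl) (by positivity)
      rw [h1, norm_mul, norm_mul, Complex.norm_real, Complex.norm_real,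
        Real.norm_of_nonneg hθ, Real.norm_of_nonneg hr0.le]
      calc _ ≤ θ * a ^ α * (θ * a ^ α + a⁻¹ * (L * (θ * a ^ α))) :=
            mul_le_mul_of_nonneg_left (norm_add_le_of_le h3 h4) (by positivity)
        _ = (a ^ α * (a ^ α + a⁻¹ * (L * a ^ α))) * θ ^ 2 := by ring
        _ ≤ K * θ ^ 2 := by
            refine mul_le_mul_of_nonneg_right ?_ (sq_nonneg θ)
            rw [hK]
            linarith

/-! ### The Volterra equation -/

lemma exists_Mtail_le {α a : ℝ} (hα : 0 < α) (ha : 0 < a) :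
    ∃ θ₁ : ℝ, 0 < θ₁ ∧ ∀ θ, 0 ≤ θ → θ < θ₁ →
      IntegrableOn (Mfun α θ) (Ioi a) ∧ Mtail α θ a ≤ 1 / 2 := by
  set γ : ℝ := min 1 (1 / (2 * α)) with hγ
  have hγ0 : 0 < γ := lt_min one_pos (by positivity)
  have hγ1 : γ ≤ 1 := min_le_left _ _
  have hαγ : α * γ ≤ 1 / 2 := by
    calc α * γ ≤ α * (1 / (2 * α)) := mul_le_mul_of_nonneg_left (min_le_right _ _) hα.le
      _ = 1 / 2 := by field_simp
  have hβ : α * γ - 2 < -1 := by linarith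
  set E₀ : ℝ := (α ^ 2 + α) * (a ^ (α * γ - 2 + 1) / (-(α * γ - 2 + 1))) with hE₀
  have h1 : Tendsto (fun θ : ℝ => θ ^ γ * E₀) (𝓝 0) (𝓝 0) := by
    have := (Real.continuousAt_rpow_const 0 γ (Or.inr hγ0.le)).tendsto.mul_const E₀
    rwa [Real.zero_rpow hγ0.ne', zero_mul] at this
  obtain ⟨θ₁, hθ₁, h2⟩ := Metric.eventually_nhds_iff.1
    (h1.eventually (ge_mem_nhds (by norm_num : (0 : ℝ) < 1 / 2)))
  refine ⟨θ₁, hθ₁, fun θ hθ hθlt => ?_⟩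
  have hb : ∀ t ∈ Ici a, ‖(Mfun α θ t : ℂ)‖ ≤ (α ^ 2 + α) * θ ^ γ * t ^ (α * γ - 2) := by
    intro t ht
    rw [Complex.norm_real, Real.norm_eq_abs]
    exact abs_Mfun_le hα hθ (ha.trans_le ht) hγ0 hγ1
  have hI := integrableOn_Ioi_of_norm_le_rpow hβ ha (Complex.continuous_ofReal.comp_continuousOn
    ((continuousOn_Mfun hα hθ).mono fun t ht => ha.trans_le ht)) hb
  have hI' : IntegrableOn (Mfun α θ) (Ioi a) := hI.re
  refine ⟨hI', ?_⟩
  have h3 := norm_integral_Ioi_le_of_norm_le_rpow (f := fun t => ((|Mfun α θ t| : ℝ) : ℂ))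
    hβ ha fun t ht => by
      have := hb t (Ioi_subset_Ici_self ht)
      rwa [Complex.norm_real, norm_abs_eq_norm, ← Complex.norm_real]
  rw [integral_complex_ofReal, Complex.norm_real] at h3
  calc Mtail α θ a ≤ _ := (le_abs_self _).trans h3
    _ = θ ^ γ * E₀ := by rw [hE₀]; ring
    _ ≤ 1 / 2 := h2 (by rwa [Real.dist_eq, sub_zero, abs_of_nonneg hθ])

lemma norm_integral_add_integral_Ioi_le {f g M : ℝ → ℂ} {a x C : ℝ} (hx : a ≤ x)
    (hM : IntegrableOn (fun y => ‖M y‖) (Ioi a)) (hf : ∀ y ∈ Ici a, ‖f y‖ ≤ C * ‖M y‖)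
    (hg : ∀ y ∈ Ici a, ‖g y‖ ≤ C * ‖M y‖) :
    ‖(∫ y in a..x, f y)‖ + ‖∫ y in Ioi x, g y‖ ≤ C * ∫ y in Ioi a, ‖M y‖ := by
  have h1 := hM.mono_set (Ioc_subset_Ioi_self : Ioc a x ⊆ Ioi a)
  have h2 := hM.mono_set (Ioi_subset_Ioi hx)
  rw [← Ioc_union_Ioi_eq_Ioi hx, setIntegral_union
    Ioc_disjoint_Ioi_same measurableSet_Ioi h1 h2,
    mul_add, intervalIntegral.integral_of_le hx]
  rw [← integral_const_mul, ← integral_const_mul]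
  refine add_le_add ?_ ?_
  · refine norm_integral_le_of_norm_le (h1.const_mul C) ?_
    filter_upwards [ae_restrict_mem measurableSet_Ioc] with y hy using hf y hy.1.le
  · refine norm_integral_le_of_norm_le (h2.const_mul C) ?_
    filter_upwards [ae_restrict_mem measurableSet_Ioi] with y hy
      using hg y (hx.trans (Ioi_subset_Ici_self hy))

lemma norm_exp_I_mul (r : ℝ) : ‖Complex.exp (2 * Complex.I * r)‖ = 1 := by
  rw [Complex.norm_exp]
  simp

lemma norm_exp_neg_I_mul (r : ℝ) : ‖Complex.exp (-2 * Complex.I * r)‖ = 1 := by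
  rw [Complex.norm_exp]
  simp

lemma norm_inv_two_I : ‖(2 * Complex.I)⁻¹‖ = 1 / 2 := by
  simp

lemma norm_Kop_le {α θ a x C : ℝ} {S : ℝ → ℂ} (hM : IntegrableOn (Mfun α θ) (Ioi a))
    (hM' : Mtail α θ a ≤ 1 / 2) (hS : ∀ y ∈ Ici a, ‖S y‖ ≤ C) (hx : a ≤ x) :
    ‖Kop α θ a 0 S x‖ ≤ C / 4 := by
  have hC : 0 ≤ C := (norm_nonneg _).trans (hS a self_mem_Ici)
  have hMn : ∀ y, ‖(Mfun α θ y : ℂ)‖ = |Mfun α θ y| := fun y => by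
    rw [Complex.norm_real, Real.norm_eq_abs]
  have h := norm_integral_add_integral_Ioi_le (x := x) (C := C) (M := fun y => (Mfun α θ y : ℂ))
    (f := fun y => (Mfun α θ y : ℂ) * S y * Complex.exp (-2 * Complex.I *
      (1 + Complex.I * ((0 : ℝ) : ℂ)) * ((phase α θ x - phase α θ y : ℝ) : ℂ)))
    (g := fun y => (Mfun α θ y : ℂ) * S y) hx (by simp only [hMn]; exact hM.abs)
    (fun y hy => by
      rw [Complex.ofReal_zero, mul_zero, add_zero, mul_one, norm_mul, norm_exp_neg_I_mul, mul_one,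
        norm_mul, mul_comm]
      exact mul_le_mul_of_nonneg_right (hS y hy) (norm_nonneg _))
    (fun y hy => by
      rw [norm_mul, mul_comm]
      exact mul_le_mul_of_nonneg_right (hS y hy) (norm_nonneg _))
  have h1 : ‖(2 * Complex.I * (1 + Complex.I * ((0 : ℝ) : ℂ)))⁻¹‖ = 1 / 2 := by
    rw [Complex.ofReal_zero, mul_zero, add_zero, mul_one, norm_inv_two_I]
  simp only [hMn] at h
  rw [Kop, norm_mul, h1]
  have h2 : (∫ y in Ioi a, |Mfun α θ y|) ≤ 1 / 2 := hM'
  have h3 := (norm_add_le _ _).trans h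
  nlinarith

lemma IsVolterraSol.norm_le {α θ a : ℝ} {S : ℝ → ℂ} (h : IsVolterraSol α θ a S)
    (hM : IntegrableOn (Mfun α θ) (Ioi a)) (hM' : Mtail α θ a ≤ 1 / 2) :
    ∀ x ∈ Ici a, ‖S x‖ ≤ 2 := by
  obtain ⟨⟨C, hC⟩, -, heq⟩ := h
  set s := (fun x => ‖S x‖) '' Ici a
  have hne : s.Nonempty := ⟨_, a, self_mem_Ici, rfl⟩
  have hbdd : BddAbove s := ⟨C, by rintro _ ⟨x, hx, rfl⟩; exact hC x hx⟩
  have hle : ∀ x ∈ Ici a, ‖S x‖ ≤ sSup s := fun x hx => le_csSup hbdd ⟨x, hx, rfl⟩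
  have h1 : sSup s ≤ 1 + sSup s / 4 := by
    refine csSup_le hne ?_
    rintro _ ⟨x, hx, rfl⟩
    simp only
    rw [heq x hx]
    exact norm_add_le_of_le (norm_exp_neg_I_mul _).le (norm_Kop_le hM hM' hle hx)
  exact fun x hx => (hle x hx).trans (by linarith)

lemma IsVolterraSol.one_half_le_norm {α θ a : ℝ} {S : ℝ → ℂ} (h : IsVolterraSol α θ a S)
    (hM : IntegrableOn (Mfun α θ) (Ioi a)) (hM' : Mtail α θ a ≤ 1 / 2) :
    ∀ x ∈ Ici a, 1 / 2 ≤ ‖S x‖ := by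
  intro x hx
  have h1 := norm_Kop_le hM hM' (h.norm_le hM hM') hx
  have h2 := norm_sub_le_norm_add (Complex.exp (-2 * Complex.I * (phase α θ x : ℂ)))
    (Kop α θ a 0 S x)
  rw [← h.2.2 x hx, norm_exp_neg_I_mul] at h2
  linarith

/-- The Wronskian of a Jost solution and an approximate WKB solution vanishes at infinity. -/
lemma IsVolterraSol.tendsto_wronskian {α θ a K : ℝ} {S u u' U P : ℝ → ℂ} (hα : 0 < α)
    (hθ : 0 ≤ θ) (ha : 0 < a) (h : IsVolterraSol α θ a S)
    (hM : IntegrableOn (Mfun α θ) (Ioi a)) (hM' : Mtail α θ a ≤ 1 / 2)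
    (hu : ∀ x, HasDerivAt u (u' x) x) (huS : ∀ x ∈ Ici a, u x = S x * vminus α θ x)
    (hU : ∀ x ∈ Ici a, ‖U x‖ ≤ K * amp α θ x)
    (hP : ∀ x ∈ Ici a, ‖P x - (-(α / 4) * (1 - (spd α θ x : ℂ) ^ 2) / x -
      Complex.I * (spd α θ x : ℂ)⁻¹)‖ ≤ K / x) :
    Tendsto (fun x => u' x * U x - u x * (P x * U x)) atTop (𝓝 0) := by
  have hK : 0 ≤ K := by
    have := (norm_nonneg _).trans (hU a self_mem_Ici)
    exact nonneg_of_mul_nonneg_left this (amp_pos α hθ a)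
  have hS2 := h.norm_le hM hM'
  obtain ⟨-, hSc, heq⟩ := h
  set m : ℝ → ℂ := fun y => (Mfun α θ y : ℂ) * S y with hm
  set e : ℝ → ℂ := fun y => Complex.exp (2 * Complex.I * (phase α θ y : ℂ)) with he
  have hMn : ∀ y, ‖(Mfun α θ y : ℂ)‖ = |Mfun α θ y| := fun y => by
    rw [Complex.norm_real, Real.norm_eq_abs]
  have hmle : ∀ y ∈ Ici a, ‖m y‖ ≤ 2 * |Mfun α θ y| := fun y hy => by
    rw [hm]
    simp only
    rw [norm_mul, mul_comm, hMn]
    exact mul_le_mul_of_nonneg_right (hS2 y hy) (abs_nonneg _)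
  have hmc : ContinuousOn m (Ici a) := (Complex.continuous_ofReal.comp_continuousOn
    ((continuousOn_Mfun hα hθ).mono fun t ht => ha.trans_le ht)).mul hSc
  have hmi : IntegrableOn m (Ioi a) := by
    refine (hM.abs.const_mul 2).mono'
      ((hmc.mono Ioi_subset_Ici_self).aestronglyMeasurable measurableSet_Ioi) ?_
    filter_upwards [ae_restrict_mem measurableSet_Ioi] with y hy
      using hmle y (Ioi_subset_Ici_self hy)
  have hec : Continuous e := by
    have := continuous_phase hα hθ
    fun_prop
  have hmec : ContinuousOn (fun y => m y * e y) (Ici a) := hmc.mul hec.continuousOn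
  set T : ℝ → ℂ := fun x => 1 + (2 * Complex.I)⁻¹ * ∫ y in a..x, m y * e y with hT
  set τ : ℝ → ℂ := fun x => (2 * Complex.I)⁻¹ * ∫ y in Ioi x, m y with hτ
  have hτ0 : Tendsto τ atTop (𝓝 0) := by
    have h1 := intervalIntegral_tendsto_integral_Ioi a hmi tendsto_id
    have h2 := ((h1.const_sub (∫ y in Ioi a, m y)).const_mul (2 * Complex.I)⁻¹)
    rw [sub_self, mul_zero] at h2
    refine h2.congr' ?_
    filter_upwards [eventually_ge_atTop a] with x hx
    have h3 := setIntegral_union Ioc_disjoint_Ioi_same measurableSet_Ioi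
      (hmi.mono_set (Ioc_subset_Ioi_self : Ioc a x ⊆ Ioi a)) (hmi.mono_set (Ioi_subset_Ioi hx))
    rw [Ioc_union_Ioi_eq_Ioi hx, ← intervalIntegral.integral_of_le hx] at h3
    rw [h3, hτ]
    simp
  have hTle : ∀ x ∈ Ici a, ‖T x‖ ≤ 3 / 2 := by
    intro x hx
    have h1 := norm_integral_add_integral_Ioi_le (x := x) (C := 2) (g := m)
      (M := fun y => (Mfun α θ y : ℂ)) (f := fun y => m y * e y) hx
      (by simp only [hMn]; exact hM.abs)
      (fun y hy => by
        simp only [he]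
        rw [norm_mul, norm_exp_I_mul, mul_one, hMn]
        exact hmle y hy)
      (fun y hy => by
        rw [hMn]
        exact hmle y hy)
    simp only [hMn] at h1
    have h2 : (∫ y in Ioi a, |Mfun α θ y|) ≤ 1 / 2 := hM'
    have h3 : ‖(2 * Complex.I)⁻¹ * ∫ y in a..x, m y * e y‖ ≤ 1 / 2 := by
      rw [norm_mul, norm_inv_two_I]
      linarith [norm_nonneg (∫ y in Ioi x, m y)]
    exact (norm_add_le_of_le norm_one.le h3).trans (by norm_num)
  have hexp : ∀ x, Complex.exp (-2 * Complex.I * (phase α θ x : ℂ)) * vminus α θ x =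
      vplus α θ x := by
    intro x
    rw [vplus, vminus, mul_left_comm, ← Complex.exp_add]
    congr 2
    ring
  have hexp' : ∀ x, e x * vplus α θ x = vminus α θ x := by
    intro x
    rw [vplus, vminus, he, mul_left_comm, ← Complex.exp_add]
    congr 2
    ring
  have hdecomp : ∀ x ∈ Ici a, u x = T x * vplus α θ x + τ x * vminus α θ x := by
    intro x hx
    have h1 : (∫ y in a..x, (Mfun α θ y : ℂ) * S y * Complex.exp (-2 * Complex.I *
        (1 + Complex.I * ((0 : ℝ) : ℂ)) * ((phase α θ x - phase α θ y : ℝ) : ℂ))) =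
        Complex.exp (-2 * Complex.I * (phase α θ x : ℂ)) * ∫ y in a..x, m y * e y := by
      rw [← intervalIntegral.integral_const_mul]
      congr 1
      ext y
      rw [mul_left_comm, ← Complex.exp_add]
      congr 2
      push_cast
      ring
    rw [huS x hx, heq x hx, Kop, h1, ← hexp x, hT, hτ]
    simp only [Complex.ofReal_zero, mul_zero, add_zero, mul_one]
    ring
  have hderiv : ∀ x ∈ Ioi a, u' x =
      T x * ((-(α / 4) * (1 - (spd α θ x : ℂ) ^ 2) / x - Complex.I * (spd α θ x : ℂ)⁻¹) *
        vplus α θ x) +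
      τ x * ((-(α / 4) * (1 - (spd α θ x : ℂ) ^ 2) / x + Complex.I * (spd α θ x : ℂ)⁻¹) *
        vminus α θ x) := by
    intro x hx
    have hx0 : 0 < x := ha.trans hx
    have h1 : HasDerivAt (fun z => ∫ y in a..z, m y * e y) (m x * e x) x := by
      have hmec' := hmec.mono (Ioi_subset_Ici_self : Ioi a ⊆ Ici a)
      refine intervalIntegral.integral_hasDerivAt_right
        (ContinuousOn.intervalIntegrable_of_Icc (le_of_lt hx) (hmec.mono fun y hy => hy.1))
        (hmec'.stronglyMeasurableAtFilter isOpen_Ioi x hx) (hmec'.continuousAt (Ioi_mem_nhds hx))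
    have h2 := (h1.const_mul (2 * Complex.I)⁻¹).const_add 1
    have h3 := (hasDerivAt_integral_Ioi hmi hmc hx).const_mul (2 * Complex.I)⁻¹
    have h4 := (h2.mul (hasDerivAt_vplus hα hθ hx0)).add (h3.mul (hasDerivAt_vminus hα hθ hx0))
    have h5 := (hu x).congr_of_eventuallyEq (f₁ := fun x => T x * vplus α θ x + τ x * vminus α θ x)
      (by
        filter_upwards [lt_mem_nhds hx] with y hy using (hdecomp y (Ioi_subset_Ici_self hy)).symm)
    rw [h5.unique h4, hT, hτ, ← hexp' x]
    ring
  refine squeeze_zero_norm' (a := fun x => 3 / 2 * K * (K / x) + ‖τ x‖ * (K * (K / a + 2))) ?_ ?_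
  · filter_upwards [eventually_gt_atTop a] with x hx
    have hx' : x ∈ Ici a := Ioi_subset_Ici_self hx
    have hx0 : 0 < x := ha.trans hx
    set D : ℂ := P x - (-(α / 4) * (1 - (spd α θ x : ℂ) ^ 2) / x - Complex.I * (spd α θ x : ℂ)⁻¹)
      with hD
    have hDle : ‖D‖ ≤ K / x := hP x hx'
    have hs := spd_pos α hθ x
    have hs1 := spd_le_one α hθ x
    have hb := amp_pos α hθ x
    have hb1 := amp_le_one α hθ x
    have hb2 := amp_sq α hθ x
    have hUx := hU x hx'
    have hTx := hTle x hx'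
    have h1 : u' x * U x - u x * (P x * U x) = -(T x * vplus α θ x * U x * D) +
        τ x * (vminus α θ x * U x * (2 * Complex.I * (spd α θ x : ℂ)⁻¹ - D)) := by
      rw [hderiv x hx, hdecomp x hx', hD]
      ring
    rw [h1]
    refine norm_add_le_of_le ?_ ?_
    · rw [norm_neg, norm_mul, norm_mul, norm_mul, norm_vplus α hθ]
      have h2 : ‖U x‖ ≤ K := hUx.trans (mul_le_of_le_one_right hK hb1)
      calc ‖T x‖ * amp α θ x * ‖U x‖ * ‖D‖ ≤ 3 / 2 * 1 * K * (K / x) := by gcongr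
        _ = _ := by ring
    · rw [norm_mul]
      refine mul_le_mul_of_nonneg_left ?_ (norm_nonneg _)
      rw [norm_mul, norm_mul, norm_vminus α hθ]
      have h2 : ‖2 * Complex.I * (spd α θ x : ℂ)⁻¹ - D‖ ≤ 2 * (spd α θ x)⁻¹ + K / a := by
        refine norm_sub_le_of_le ?_ (hDle.trans (div_le_div_of_nonneg_left hK ha hx'))
        rw [norm_mul, norm_mul, norm_inv, Complex.norm_real, Real.norm_of_nonneg hs.le]
        simp
      calc _ ≤ amp α θ x * (K * amp α θ x) * (2 * (spd α θ x)⁻¹ + K / a) := by gcongr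
        _ = K * (2 + spd α θ x * (K / a)) := by
          rw [← hb2]
          field_simp
        _ ≤ K * (K / a + 2) := by
          have : spd α θ x * (K / a) ≤ K / a := mul_le_of_le_one_left (by positivity) hs1
          exact mul_le_mul_of_nonneg_left (by linarith) hK
  · have h1 : Tendsto (fun x : ℝ => 3 / 2 * K * (K / x)) atTop (𝓝 0) := by
      simpa using (tendsto_const_nhds.div_atTop tendsto_id).const_mul (3 / 2 * K)
    simpa using h1.add (hτ0.norm.mul_const (K * (K / a + 2)))

/-! ### Asymptotics of the Jost solution at `a` -/

lemma exists_bound_jost_deriv {α a : ℝ} (hα : 0 < α) (ha : 0 < a) :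
    ∃ C θ₁ : ℝ, ∃ η : ℂ, 0 ≤ C ∧ 0 < θ₁ ∧ θ₁ ≤ 1 ∧
      η * Complex.exp (-(2 * Complex.I) * a) +
        (∫ y in (0 : ℝ)..a, ((y ^ α : ℝ) : ℂ) * Complex.exp (-(2 * Complex.I) * y)) =
        Real.Gamma (α + 1) / (2 * Complex.I) ^ ((α : ℂ) + 1) ∧
      ∀ θ, 0 < θ → θ < θ₁ → Mtail α θ a ≤ 1 / 2 ∧
        ∀ S u u' : ℝ → ℂ, IsVolterraSol α θ a S → (∀ x, HasDerivAt u (u' x) x) →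
          (∀ x, HasDerivAt u' (-((spd α θ x : ℂ))⁻¹ ^ 2 * u x) x) →
          (∀ x ∈ Ici a, u x = S x * vminus α θ x) →
          ‖u' a - u a * (-Complex.I + θ * η)‖ ≤ C * θ ^ 2 ∧ 1 / 4 ≤ ‖u a‖ ∧ ‖u a‖ ≤ 2 := by
  obtain ⟨N, K₁, θ₂, q, hq, G, hG, hN, hK₁, hθ₂, hθ₂1, hqd, happ⟩ := exists_approx_solution hα ha
  obtain ⟨K₂, hK₂, hGK⟩ := exists_bound_of_mem_profileAlg ha hG
  obtain ⟨K₃, hK₃, hGL⟩ := exists_lipschitz_of_mem_profileAlg ha hG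
  obtain ⟨θ₃, hθ₃, hM⟩ := exists_Mtail_le hα ha
  set K : ℝ := K₁ + K₂ + K₃ + 2 with hK
  have hK0 : 0 ≤ K := by positivity
  have hGc : ∀ θ, 0 ≤ θ → ContinuousOn (G θ) (Ici a) := fun θ hθ =>
    (continuousOn_of_mem_profileAlg hθ hG).mono fun y hy => ha.trans_le hy
  obtain ⟨C, hC, hcmp⟩ := exists_bound_deriv_sub_of_approx hα ha hN hK0 (hGc 0 le_rfl)
    fun x hx => (hGK 0 x le_rfl hx).trans (by linarith)
  have hr0 : 0 < a ^ α := Real.rpow_pos_of_pos ha α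
  set J : ℂ := ∫ y in Ioi a, ((y ^ (α - N) : ℝ) : ℂ) * G 0 y *
    Complex.exp (-(2 * Complex.I) * (y - a)) with hJ
  refine ⟨C + 2 * K₁, min (min θ₂ θ₃) (1 / (2 * a ^ α)), ((a ^ α : ℝ) : ℂ) * q 0 a + J,
    by positivity, by positivity, (min_le_left _ _).trans ((min_le_left _ _).trans hθ₂1), ?_, ?_⟩
  · rw [← boundary_add_integral_eq_Gamma hα ha (by linarith) hq hG hqd, add_mul, hJ,
      ← integral_mul_const]
    congr 3
    ext y
    rw [mul_assoc, ← Complex.exp_add]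
    congr 2
    ring
  · intro θ hθ hθlt
    have hlt₂ : θ < θ₂ := hθlt.trans_le ((min_le_left _ _).trans (min_le_left _ _))
    have hlt₃ : θ < θ₃ := hθlt.trans_le ((min_le_left _ _).trans (min_le_right _ _))
    have hlta : θ * a ^ α ≤ 1 / 2 := by
      have h := (hθlt.trans_le (min_le_right _ _)).le
      rw [le_div_iff₀ (by positivity)] at h
      linarith
    obtain ⟨hMi, hMle⟩ := hM θ hθ.le hlt₃
    refine ⟨hMle, fun S u u' hS hu hu' huS => ?_⟩
    have hS2 := hS.norm_le hMi hMle
    have hun : ∀ x ∈ Ici a, ‖u x‖ ≤ 2 := fun x hx => by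
      rw [huS x hx, norm_mul, norm_vminus α hθ.le]
      nlinarith [hS2 x hx, amp_le_one α hθ.le x, amp_pos α hθ.le x, norm_nonneg (S x)]
    have haa : a ∈ Ici a := self_mem_Ici
    refine ⟨?_, ?_, hun a haa⟩
    · obtain ⟨U, P, hU', hP', hPI, hU0, hUK, hUinv, hPK, hPa⟩ := happ θ hθ hlt₂
      have hx0 : ∀ x ∈ Ici a, 0 < x := fun x hx => ha.trans_le hx
      have hW := hS.tendsto_wronskian hα hθ.le ha hMi hMle hu huS hUK hPK
      have hmain := hcmp θ u u' U P (G θ) hθ.le (fun x _ => hu x) (fun x hx => ?_) hU' hP'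
        (hGc θ hθ.le) (fun x hx => (hGK θ x hθ.le hx).trans (by linarith))
        (fun x hx => (hGL θ x hθ.le hx).trans ?_) (fun x hx => (hPI x hx).trans ?_) hU0
        (fun x hx => (hUK x hx).trans ?_) (fun x hx => (hUinv x hx).trans ?_)
        (fun x hx => (hun x hx).trans (by linarith)) hW
      · have h1 : u' a - u a * (-Complex.I + θ * (((a ^ α : ℝ) : ℂ) * q 0 a + J)) =
            (u' a - u a * (P a + θ * J)) +
            u a * (P a + Complex.I - θ * (((a ^ α : ℝ) : ℂ) * q 0 a)) := by ring
        rw [h1]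
        refine (norm_add_le_of_le hmain ?_).trans (by rw [add_mul])
        rw [norm_mul, mul_assoc]
        exact mul_le_mul (hun a haa) hPa (norm_nonneg _) (by norm_num)
      · refine (hu' x).congr_deriv ?_
        have hs : (spd α θ x : ℂ) ≠ 0 := by exact_mod_cast (spd_pos α hθ.le x).ne'
        have h1 : (spd α θ x : ℂ) ^ 2 * (1 + θ * ((x ^ α : ℝ) : ℂ)) = 1 := by
          exact_mod_cast spd_sq_mul α hθ.le (hx0 x hx)
        rw [inv_pow, inv_eq_of_mul_eq_one_right h1]
      · have := Real.rpow_nonneg (hx0 x hx).le α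
        exact mul_le_mul_of_nonneg_right (by linarith) (by positivity)
      · have := Real.rpow_nonneg (hx0 x hx).le α
        exact mul_le_mul_of_nonneg_right (by linarith) (by positivity)
      · exact (mul_le_of_le_one_right hK₁ (amp_le_one α hθ.le x)).trans (by linarith)
      · exact mul_le_mul_of_nonneg_right (by linarith) (Real.rpow_nonneg (hx0 x hx).le α)
    · have h1 := hS.one_half_le_norm hMi hMle a haa
      have h2 := one_sub_spd_le α hθ.le ha
      have h3 := amp_sq α hθ.le a
      have h4 := amp_le_one α hθ.le a
      have h5 := amp_pos α hθ.le a
      rw [huS a haa, norm_mul, norm_vminus α hθ.le]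
      nlinarith

/-! ### Propagation from `a` to the origin -/

lemma exists_bound_ratio {α a C₀ : ℝ} (hα : 0 < α) (ha : 0 < a) (hC₀ : 0 ≤ C₀) (η L : ℂ)
    (hL : η * Complex.exp (-(2 * Complex.I) * a) +
      (∫ y in (0 : ℝ)..a, ((y ^ α : ℝ) : ℂ) * Complex.exp (-(2 * Complex.I) * y)) = L) :
    ∃ C θ₁ : ℝ, 0 ≤ C ∧ 0 < θ₁ ∧ ∀ (θ : ℝ) (u u' : ℝ → ℂ) (A B : ℂ), 0 < θ → θ < θ₁ →
      (∀ x, HasDerivAt u (u' x) x) →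
      (∀ x, 0 ≤ x → HasDerivAt u' (-(1 + θ * ((x ^ α : ℝ) : ℂ)) * u x) x) →
      ‖u' a - u a * (-Complex.I + θ * η)‖ ≤ C₀ * θ ^ 2 → 1 / 4 ≤ ‖u a‖ → ‖u a‖ ≤ 2 →
      (∀ x : ℝ, x ≤ 0 → u x = B * Complex.exp (-Complex.I * (x : ℂ)) +
        A * Complex.exp (Complex.I * (x : ℂ))) →
      B ≠ 0 ∧ ‖A / B - L / (2 * Complex.I) * θ‖ ≤ C * θ ^ 2 := by
  have hr0 : 0 < a ^ α := Real.rpow_pos_of_pos ha α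
  set ρ : ℝ := a ^ α * a with hρ
  have hρ0 : 0 < ρ := by positivity
  set k : ℝ := 2 * ‖η‖ + C₀ with hk
  have hk0 : 0 ≤ k := by positivity
  set m₀ : ℝ := 2 * k + 4 with hm₀
  have hm₀0 : 0 ≤ m₀ := by positivity
  set k₂ : ℝ := k + ρ * m₀ with hk₂
  have hk₂0 : 0 ≤ k₂ := by positivity
  refine ⟨4 * (C₀ + ρ * k₂ + ‖L‖ * k₂), min 1 (min (1 / (2 * ρ)) (1 / (8 * (k₂ + 1)))),
    by positivity, by positivity, ?_⟩
  intro θ u u' A B hθ hθlt hu hu' hder hua hua2 hAB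
  have hθ1 : θ ≤ 1 := (hθlt.trans_le (min_le_left _ _)).le
  have hθρ : θ * ρ ≤ 1 / 2 := by
    have h := (hθlt.trans_le ((min_le_right _ _).trans (min_le_left _ _))).le
    rw [le_div_iff₀ (by positivity)] at h
    linarith
  have hθk : θ * k₂ ≤ 1 / 8 := by
    have h := (hθlt.trans_le ((min_le_right _ _).trans (min_le_right _ _))).le
    rw [le_div_iff₀ (by positivity)] at h
    linarith
  have hua' : ‖u' a + Complex.I * u a‖ ≤ θ * k := by
    have h1 : u' a + Complex.I * u a = (u' a - u a * (-Complex.I + θ * η)) + u a * (θ * η) := by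
      ring
    rw [h1]
    have h2 : ‖u a * (θ * η)‖ ≤ 2 * (θ * ‖η‖) := by
      rw [norm_mul, norm_mul, Complex.norm_real, Real.norm_of_nonneg hθ.le]
      exact mul_le_mul_of_nonneg_right hua2 (by positivity)
    refine (norm_add_le_of_le hder h2).trans ?_
    have : C₀ * θ ^ 2 ≤ C₀ * θ := mul_le_mul_of_nonneg_left (by nlinarith) hC₀
    rw [hk]
    linarith
  have hen : ∀ x : ℝ, ‖Complex.exp (Complex.I * x)‖ = 1 := fun x => by
    rw [Complex.norm_exp]
    simp
  have hen' : ∀ x : ℝ, ‖Complex.exp (-Complex.I * x)‖ = 1 := fun x => by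
    rw [Complex.norm_exp]
    simp
  obtain ⟨Zp, hZp⟩ : ∃ Z : ℝ → ℂ,
    Z = fun x : ℝ => Complex.exp (-Complex.I * x) * (u' x + Complex.I * u x) := ⟨_, rfl⟩
  obtain ⟨Zm, hZm⟩ : ∃ Z : ℝ → ℂ,
    Z = fun x : ℝ => Complex.exp (Complex.I * x) * (u' x - Complex.I * u x) := ⟨_, rfl⟩
  have hZpd : ∀ x, 0 ≤ x → HasDerivAt Zp
      (-(θ * (((x ^ α : ℝ) : ℂ) * (Complex.exp (-Complex.I * x) * u x)))) x := by
    intro x hx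
    rw [hZp]
    refine (((hasDerivAt_id x).ofReal_comp.const_mul (-Complex.I)).cexp.mul
      ((hu' x hx).add ((hu x).const_mul Complex.I))).congr_deriv ?_
    simp only [id, Complex.ofReal_one, mul_one, Pi.add_apply]
    linear_combination (-(Complex.exp (-Complex.I * x) * u x)) * Complex.I_sq
  have hZmd : ∀ x, 0 ≤ x → HasDerivAt Zm
      (-(θ * (((x ^ α : ℝ) : ℂ) * (Complex.exp (Complex.I * x) * u x)))) x := by
    intro x hx
    rw [hZm]
    refine (((hasDerivAt_id x).ofReal_comp.const_mul Complex.I).cexp.mul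
      ((hu' x hx).sub ((hu x).const_mul Complex.I))).congr_deriv ?_
    simp only [id, Complex.ofReal_one, mul_one, Pi.sub_apply]
    linear_combination (-(Complex.exp (Complex.I * x) * u x)) * Complex.I_sq
  have huc : Continuous u := continuous_iff_continuousAt.2 fun x => (hu x).continuousAt
  have hu2 : ∀ x, 2 * Complex.I * u x =
      Complex.exp (Complex.I * x) * Zp x - Complex.exp (-Complex.I * x) * Zm x := by
    intro x
    have h1 : Complex.exp (Complex.I * x) * Complex.exp (-Complex.I * x) = 1 := by
      rw [← Complex.exp_add]
      simp
    rw [hZp, hZm]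
    linear_combination (-(2 * Complex.I * u x)) * h1
  obtain ⟨x₁, hx₁, hmax⟩ := isCompact_Icc.exists_isMaxOn (nonempty_Icc.2 ha.le)
    huc.norm.continuousOn
  set m : ℝ := ‖u x₁‖ with hm
  have hum : ∀ x ∈ Icc 0 a, ‖u x‖ ≤ m := fun x hx => hmax hx
  have hm0 : 0 ≤ m := norm_nonneg _
  have hpow : ∀ x ∈ Icc 0 a, ‖((x ^ α : ℝ) : ℂ)‖ ≤ a ^ α := fun x hx => by
    rw [Complex.norm_real, Real.norm_of_nonneg (Real.rpow_nonneg hx.1 α)]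
    exact Real.rpow_le_rpow hx.1 hx.2 hα.le
  have hmvt : ∀ (Z : ℝ → ℂ) (E : ℝ → ℂ), (∀ x : ℝ, ‖E x‖ = 1) →
      (∀ x, 0 ≤ x → HasDerivAt Z (-(θ * (((x ^ α : ℝ) : ℂ) * (E x * u x)))) x) →
      ∀ x ∈ Icc 0 a, ‖Z x - Z a‖ ≤ θ * ρ * m := by
    intro Z E hE hZ x hx
    have h1 := (convex_Icc (0 : ℝ) a).norm_image_sub_le_of_norm_hasDerivWithin_le
      (C := θ * (a ^ α * m)) (fun y hy => (hZ y hy.1).hasDerivWithinAt) (fun y hy => ?_)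
      (right_mem_Icc.2 ha.le) hx
    · refine h1.trans ?_
      have h2 : ‖x - a‖ ≤ a := by
        rw [Real.norm_eq_abs, abs_le]
        constructor <;> linarith [hx.1, hx.2]
      calc θ * (a ^ α * m) * ‖x - a‖ ≤ θ * (a ^ α * m) * a := by gcongr
        _ = θ * ρ * m := by rw [hρ]; ring
    · rw [norm_neg, norm_mul, norm_mul, norm_mul, hE, one_mul, Complex.norm_real,
        Real.norm_of_nonneg hθ.le]
      have := hpow y hy
      have := hum y hy
      gcongr
  have hZpm := hmvt Zp _ hen' hZpd
  have hZmm := hmvt Zm _ hen hZmd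
  have hZpa : ‖Zp a‖ ≤ θ * k := by
    rw [hZp]
    simp only
    rwa [norm_mul, hen', one_mul]
  have hZma' : ‖Zm a + 2 * Complex.I * (Complex.exp (Complex.I * a) * u a)‖ ≤ θ * k := by
    have h1 : Zm a + 2 * Complex.I * (Complex.exp (Complex.I * a) * u a) =
        Complex.exp (Complex.I * a) * (u' a + Complex.I * u a) := by
      rw [hZm]
      ring
    rwa [h1, norm_mul, hen, one_mul]
  have h2I : ‖(2 * Complex.I : ℂ)‖ = 2 := by simp
  have hZma : ‖Zm a‖ ≤ θ * k + 4 := by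
    have h1 := norm_sub_le (Zm a + 2 * Complex.I * (Complex.exp (Complex.I * a) * u a))
      (2 * Complex.I * (Complex.exp (Complex.I * a) * u a))
    rw [add_sub_cancel_right, norm_mul (2 * Complex.I), h2I, norm_mul, hen] at h1
    linarith
  have hθk1 : θ * k ≤ k := mul_le_of_le_one_left hk0 hθ1
  have hmle : m ≤ m₀ := by
    have h1 : ‖2 * Complex.I * u x₁‖ ≤ ‖Zp x₁‖ + ‖Zm x₁‖ := by
      rw [hu2 x₁]
      refine (norm_sub_le _ _).trans ?_
      rw [norm_mul, norm_mul, hen, hen', one_mul, one_mul]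
    rw [norm_mul, h2I] at h1
    have h2 := norm_le_norm_add_norm_sub' (Zp x₁) (Zp a)
    have h3 := norm_le_norm_add_norm_sub' (Zm x₁) (Zm a)
    have h4 := hZpm x₁ hx₁
    have h5 := hZmm x₁ hx₁
    have h6 : θ * ρ * m ≤ 1 / 2 * m := mul_le_mul_of_nonneg_right hθρ hm0
    linarith
  have hρm : θ * ρ * m ≤ θ * (ρ * m₀) := by
    rw [mul_assoc]
    gcongr
  have hZp' : ∀ x ∈ Icc 0 a, ‖Zp x‖ ≤ θ * k₂ := by
    intro x hx
    have h2 := norm_le_norm_add_norm_sub' (Zp x) (Zp a)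
    have h4 := hZpm x hx
    rw [hk₂, mul_add]
    linarith
  have hZm' : ∀ x ∈ Icc 0 a,
      ‖Zm x + 2 * Complex.I * (Complex.exp (Complex.I * a) * u a)‖ ≤ θ * k₂ := by
    intro x hx
    have h1 : Zm x + 2 * Complex.I * (Complex.exp (Complex.I * a) * u a) =
      (Zm a + 2 * Complex.I * (Complex.exp (Complex.I * a) * u a)) + (Zm x - Zm a) := by ring
    rw [h1, hk₂, mul_add]
    exact norm_add_le_of_le hZma' ((hZmm x hx).trans hρm)
  have huapp : ∀ x ∈ Icc 0 a, ‖u x - Complex.exp (-Complex.I * x) *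
      (Complex.exp (Complex.I * a) * u a)‖ ≤ θ * k₂ := by
    intro x hx
    have h1 : 2 * Complex.I * (u x - Complex.exp (-Complex.I * x) *
        (Complex.exp (Complex.I * a) * u a)) = Complex.exp (Complex.I * x) * Zp x -
        Complex.exp (-Complex.I * x) *
          (Zm x + 2 * Complex.I * (Complex.exp (Complex.I * a) * u a)) := by
      rw [mul_sub, hu2 x]
      ring
    have h2 := norm_sub_le (Complex.exp (Complex.I * x) * Zp x) (Complex.exp (-Complex.I * x) *
          (Zm x + 2 * Complex.I * (Complex.exp (Complex.I * a) * u a)))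
    rw [← h1, norm_mul, h2I, norm_mul, norm_mul, hen, hen', one_mul, one_mul] at h2
    linarith [hZp' x hx, hZm' x hx]
  have h0mem : (0 : ℝ) ∈ Icc 0 a := left_mem_Icc.2 ha.le
  have hu0 : u 0 = B + A := by simpa using hAB 0 le_rfl
  have hu'0 : u' 0 = -Complex.I * B + Complex.I * A := by
    have h1 : HasDerivAt (fun x : ℝ => B * Complex.exp (-Complex.I * (x : ℂ)) +
        A * Complex.exp (Complex.I * (x : ℂ))) (-Complex.I * B + Complex.I * A) 0 := by
      refine ((((hasDerivAt_id (0 : ℝ)).ofReal_comp.const_mul (-Complex.I)).cexp.const_mul B).add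
        (((hasDerivAt_id (0 : ℝ)).ofReal_comp.const_mul Complex.I).cexp.const_mul A)).congr_deriv ?_
      simp only [id, Complex.ofReal_zero, Complex.ofReal_one, mul_zero, Complex.exp_zero]
      ring
    exact (uniqueDiffWithinAt_Iic (0 : ℝ)).eq_deriv _ (hu 0).hasDerivWithinAt
      (h1.hasDerivWithinAt.congr (fun x hx => hAB x hx) (hAB 0 le_rfl))
  have hZp0 : Zp 0 = 2 * Complex.I * A := by
    rw [hZp]
    simp only [Complex.ofReal_zero, mul_zero, Complex.exp_zero, hu0, hu'0]
    ring
  have hZm0 : Zm 0 = -(2 * Complex.I * B) := by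
    rw [hZm]
    simp only [Complex.ofReal_zero, mul_zero, Complex.exp_zero, hu0, hu'0]
    ring
  set w : ℂ := Complex.exp (Complex.I * a) * u a with hw
  have hwn : ‖w‖ = ‖u a‖ := by rw [hw, norm_mul, hen, one_mul]
  have hBw : ‖w - B‖ ≤ θ * k₂ := by
    have h1 := hZm' 0 h0mem
    have h2 : Zm 0 + 2 * Complex.I * w = 2 * Complex.I * (w - B) := by
      rw [hZm0]
      ring
    rw [h2, norm_mul, h2I] at h1
    linarith [norm_nonneg (w - B)]
  have hBn : 1 / 8 ≤ ‖B‖ := by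
    have := norm_le_norm_add_norm_sub' w B
    linarith
  have hB0 : B ≠ 0 := norm_pos_iff.1 (by linarith)
  have hrc : Continuous fun x : ℝ => ((x ^ α : ℝ) : ℂ) :=
    Complex.continuous_ofReal.comp (Real.continuous_rpow_const hα.le)
  have hint : 2 * Complex.I * A = Zp a + θ * ∫ x in (0 : ℝ)..a,
      ((x ^ α : ℝ) : ℂ) * (Complex.exp (-Complex.I * x) * u x) := by
    have h1 := intervalIntegral.integral_eq_sub_of_hasDerivAt (a := 0) (b := a)
      (fun x hx => hZpd x (by rw [uIcc_of_le ha.le] at hx; exact hx.1))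
      (Continuous.intervalIntegrable (by fun_prop) _ _)
    rw [intervalIntegral.integral_neg, intervalIntegral.integral_const_mul] at h1
    rw [← hZp0]
    linear_combination h1
  have hidiff : ‖(∫ x in (0 : ℝ)..a, ((x ^ α : ℝ) : ℂ) * (Complex.exp (-Complex.I * x) * u x)) -
      (∫ y in (0 : ℝ)..a, ((y ^ α : ℝ) : ℂ) * Complex.exp (-(2 * Complex.I) * y)) * w‖ ≤
      θ * (ρ * k₂) := by
    rw [← intervalIntegral.integral_mul_const, ← intervalIntegral.integral_sub
      (Continuous.intervalIntegrable (by fun_prop) _ _)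
      (Continuous.intervalIntegrable (by fun_prop) _ _)]
    have h1 := intervalIntegral.norm_integral_le_of_norm_le_const (a := 0) (b := a)
      (C := a ^ α * (θ * k₂)) (f := fun x : ℝ => ((x ^ α : ℝ) : ℂ) *
        (Complex.exp (-Complex.I * x) * u x) -
        ((x ^ α : ℝ) : ℂ) * Complex.exp (-(2 * Complex.I) * x) * w) fun x hx => ?_
    · refine h1.trans (le_of_eq ?_)
      rw [sub_zero, abs_of_pos ha, hρ]
      ring
    · rw [uIoc_of_le ha.le] at hx
      have hx' : x ∈ Icc 0 a := Ioc_subset_Icc_self hx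
      have h2 : Complex.exp (-(2 * Complex.I) * x) =
          Complex.exp (-Complex.I * x) * Complex.exp (-Complex.I * x) := by
        rw [← Complex.exp_add]
        congr 1
        ring
      have h3 : ((x ^ α : ℝ) : ℂ) * (Complex.exp (-Complex.I * x) * u x) -
          ((x ^ α : ℝ) : ℂ) * Complex.exp (-(2 * Complex.I) * x) * w =
          ((x ^ α : ℝ) : ℂ) * (Complex.exp (-Complex.I * x) *
            (u x - Complex.exp (-Complex.I * x) * w)) := by
        rw [h2]
        ring
      rw [h3, norm_mul, norm_mul, hen', one_mul]
      exact mul_le_mul (hpow x hx') (huapp x hx') (norm_nonneg _) hr0.le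
  refine ⟨hB0, ?_⟩
  have hexp : Complex.exp (-(2 * Complex.I) * a) * Complex.exp (Complex.I * a) =
      Complex.exp (-Complex.I * a) := by
    rw [← Complex.exp_add]
    congr 1
    ring
  have hnum : 2 * Complex.I * A - L * θ * B =
      Complex.exp (-Complex.I * a) * (u' a - u a * (-Complex.I + θ * η)) +
      θ * ((∫ x in (0 : ℝ)..a, ((x ^ α : ℝ) : ℂ) * (Complex.exp (-Complex.I * x) * u x)) -
        (∫ y in (0 : ℝ)..a, ((y ^ α : ℝ) : ℂ) * Complex.exp (-(2 * Complex.I) * y)) * w) +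
      θ * (L * (w - B)) := by
    rw [hint, ← hL, hw, hZp]
    linear_combination (-(θ * η * u a)) * hexp
  have hnumle : ‖2 * Complex.I * A - L * θ * B‖ ≤ (C₀ + ρ * k₂ + ‖L‖ * k₂) * θ ^ 2 := by
    rw [hnum]
    have hsum : (C₀ + ρ * k₂ + ‖L‖ * k₂) * θ ^ 2 =
        C₀ * θ ^ 2 + θ * (θ * (ρ * k₂)) + θ * (‖L‖ * (θ * k₂)) := by ring
    rw [hsum]
    refine norm_add_le_of_le (norm_add_le_of_le ?_ ?_) ?_
    · rwa [norm_mul, hen', one_mul]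
    · rw [norm_mul, Complex.norm_real, Real.norm_of_nonneg hθ.le]
      exact mul_le_mul_of_nonneg_left hidiff hθ.le
    · rw [norm_mul, norm_mul, Complex.norm_real, Real.norm_of_nonneg hθ.le]
      gcongr
  have hfin : A / B - L / (2 * Complex.I) * θ =
      (2 * Complex.I * A - L * θ * B) / (2 * Complex.I * B) := by
    have := Complex.I_ne_zero
    field_simp
  rw [hfin, norm_div, norm_mul (2 * Complex.I), h2I, div_le_iff₀ (by linarith)]
  have hc0 : 0 ≤ (C₀ + ρ * k₂ + ‖L‖ * k₂) * θ ^ 2 := by positivity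
  nlinarith

/-- main theorem on the reflection coefficient. -/
theorem stmt0 (α x₀ : ℝ) (hα : 0 < α) (hx₀ : 0 < x₀) :
    ∃ θ₁ > (0:ℝ), ∃ C > (0:ℝ), ∀ θ : ℝ, 0 < θ → θ < θ₁ →
      Mtail α θ x₀ < 2 ∧
      ∀ S : ℝ → ℂ, IsVolterraSol α θ x₀ S →
        ∀ u u' : ℝ → ℂ,
          (∀ x : ℝ, HasDerivAt u (u' x) x) →
          (∀ x : ℝ, HasDerivAt u' (-((spd α θ x : ℂ))⁻¹ ^ 2 * u x) x) →
          (∀ x ∈ Ici x₀, u x = S x * vminus α θ x) →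
          ∀ A B : ℂ,
            (∀ x : ℝ, x ≤ 0 →
              u x = B * Complex.exp (-Complex.I * (x : ℂ)) +
                A * Complex.exp (Complex.I * (x : ℂ))) →
            B ≠ 0 ∧
              ‖A / B -
                  (Real.Gamma (α + 1) : ℂ) / (2 * Complex.I) ^ ((α : ℂ) + 2) * (θ : ℂ)‖ ≤
                C * θ ^ (1 + min (1 / α) 1) := by
  obtain ⟨C₀, θ₂, η, hC₀, hθ₂, hθ₂1, hη, hjost⟩ := exists_bound_jost_deriv hα hx₀
  obtain ⟨C, θ₃, hC, hθ₃, hratio⟩ := exists_bound_ratio hα hx₀ hC₀ η _ hη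
  refine ⟨min θ₂ θ₃, lt_min hθ₂ hθ₃, C + 1, by positivity, fun θ hθ hθlt => ?_⟩
  have hlt₂ := hθlt.trans_le (min_le_left θ₂ θ₃)
  have hlt₃ := hθlt.trans_le (min_le_right θ₂ θ₃)
  obtain ⟨hM, hS⟩ := hjost θ hθ hlt₂
  refine ⟨hM.trans_lt (by norm_num), fun S hSV u u' hu hu' huS A B hAB => ?_⟩
  obtain ⟨h1, h2, h3⟩ := hS S u u' hSV hu hu' huS
  have hu'' : ∀ x, 0 ≤ x → HasDerivAt u' (-(1 + θ * ((x ^ α : ℝ) : ℂ)) * u x) x := by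
    intro x hx
    refine (hu' x).congr_deriv ?_
    have hs := spd_sq_mul_base α hθ.le x
    rw [max_eq_left hx] at hs
    have h4 : (spd α θ x : ℂ) ^ 2 * (1 + θ * ((x ^ α : ℝ) : ℂ)) = 1 := by exact_mod_cast hs
    rw [inv_pow, inv_eq_of_mul_eq_one_right h4]
  obtain ⟨hB, hle⟩ := hratio θ u u' A B hθ hlt₃ hu hu'' h1 h2 h3 hAB
  refine ⟨hB, ?_⟩
  have h2I : (2 * Complex.I : ℂ) ≠ 0 := mul_ne_zero two_ne_zero Complex.I_ne_zero
  have hpow : (2 * Complex.I) ^ ((α : ℂ) + 2) =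
      (2 * Complex.I) ^ ((α : ℂ) + 1) * (2 * Complex.I) := by
    rw [show (α : ℂ) + 2 = α + 1 + 1 by ring, Complex.cpow_add _ _ h2I, Complex.cpow_one]
  rw [hpow, ← div_div]
  refine hle.trans ?_
  have h4 : θ ^ 2 ≤ θ ^ (1 + min (1 / α) 1) := by
    rw [← Real.rpow_two]
    exact Real.rpow_le_rpow_of_exponent_ge hθ (hlt₂.le.trans hθ₂1)
      (by linarith [min_le_right (1 / α) 1])
  exact mul_le_mul (by linarith) h4 (sq_nonneg θ) (by positivity)
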